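/- arXiv:2501.16620 — 3 statements merged into one kernel-verified Lean document; each statement's English description precedes it below -/
import Mathlib

section
/- Let k and n be integers with k ≥ 3 and n ≠ 0, and let M = {x^k + n : x ∈ ℕ} ∩ ℕ be the set of positive integers of the form x^k + n with x a positive integer. Let R be a set of positive integers such that the symmetric difference R Δ M satisfies |(R Δ M) ∩ [1, X]| = o(X^{1/k}) as X → ∞ (i.e., for every ε > 0 there exists X₀ such that |(R Δ M) ∩ [1, X]| ≤ ε·X^{1/k} for all X ≥ X₀). Then R is multiplicatively irreducible, i.e., there do not exist sets A, B of positive integers, each of size at least 2, with R = {ab : a ∈ A, b ∈ B}. -/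
open Pointwise

theorem pow_pred_le_abs_pow_sub_pow {k : ℕ} (hk : 1 ≤ k) {u v : ℕ} (h : u ≠ v) :
    (u : ℤ) ^ (k - 1) ≤ |(u : ℤ) ^ k - (v : ℤ) ^ k| := by
  have key : ∀ s t : ℕ, s < t → (t : ℤ) ^ (k - 1) ≤ (t : ℤ) ^ k - (s : ℤ) ^ k := by
    intro s t hst
    obtain ⟨j, rfl⟩ : ∃ j, k = j + 1 := ⟨k - 1, by omega⟩
    have h1 : (s : ℤ) ^ j ≤ (t : ℤ) ^ j := by
      gcongr
    have h2 : (s : ℤ) + 1 ≤ t := by exact_mod_cast hst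
    have h3 : (0 : ℤ) ≤ (t : ℤ) ^ j := by positivity
    simp only [Nat.add_sub_cancel, pow_succ]
    nlinarith [mul_le_mul_of_nonneg_right h1 (Int.natCast_nonneg s)]
  rcases lt_or_gt_of_ne h with h | h
  · calc (u : ℤ) ^ (k - 1) ≤ (v : ℤ) ^ (k - 1) := by gcongr
      _ ≤ (v : ℤ) ^ k - (u : ℤ) ^ k := key u v h
      _ ≤ _ := by rw [abs_sub_comm]; exact le_abs_self _
  · exact (key v u h).trans (le_abs_self _)

/-- Four shifted `k`-th powers at the corners of a multiplicative rectangle force the largest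
root to be at least quadratic in the smallest one. -/
theorem sq_le_of_rectangle {k : ℕ} (hk : 3 ≤ k) {n : ℤ} (hn : n ≠ 0)
    {a a' b b' x y z w : ℕ} (ha : a < a') (hb : b < b') (hx : 0 < x) (hw : 0 < w)
    (h1 : (a * b : ℤ) = x ^ k + n) (h2 : (a * b' : ℤ) = y ^ k + n)
    (h3 : (a' * b : ℤ) = z ^ k + n) (h4 : (a' * b' : ℤ) = w ^ k + n) :
    x ^ 2 ≤ 2 * n.natAbs ^ 2 * w := by
  have hn1 : 1 ≤ |n| := Int.one_le_abs hn
  have ha' : (a : ℤ) < a' := by exact_mod_cast ha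
  have hb' : (b : ℤ) < b' := by exact_mod_cast hb
  have hdiff : ((x * w : ℕ) : ℤ) ^ k - ((y * z : ℕ) : ℤ) ^ k = -(n * ((a' - a) * (b' - b))) := by
    push_cast
    rw [mul_pow, mul_pow, eq_sub_of_add_eq h1.symm, eq_sub_of_add_eq h2.symm,
      eq_sub_of_add_eq h3.symm, eq_sub_of_add_eq h4.symm]
    ring
  have hpos : (0 : ℤ) < (a' - a) * (b' - b) := mul_pos (by linarith) (by linarith)
  have hne : x * w ≠ y * z := by
    intro h
    rw [h, sub_self, eq_comm, neg_eq_zero] at hdiff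
    exact (mul_ne_zero hn hpos.ne') hdiff
  have hle := pow_pred_le_abs_pow_sub_pow (k := k) (by omega) hne
  rw [hdiff, abs_neg, abs_mul, abs_of_pos hpos] at hle
  have hw1 : (1 : ℤ) ≤ (w : ℤ) ^ k := one_le_pow₀ (by exact_mod_cast hw)
  have hrect : ((a' : ℤ) - a) * (b' - b) ≤ 2 * |n| * w ^ k := by
    have : ((a' : ℤ) - a) * (b' - b) ≤ a' * b' := by
      gcongr <;> linarith [Int.natCast_nonneg a, Int.natCast_nonneg b]
    nlinarith [le_abs_self n, mul_nonneg (sub_nonneg.2 hn1) (sub_nonneg.2 hw1)]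
  have hfin : ((x * w : ℕ) : ℤ) ^ (k - 1) ≤ (2 * |n| ^ 2 * w) * w ^ (k - 1) := by
    calc _ ≤ |n| * (2 * |n| * w ^ k) := hle.trans (by gcongr)
      _ = _ := by
        obtain ⟨j, rfl⟩ : ∃ j, k = j + 1 := ⟨k - 1, by omega⟩
        simp only [Nat.add_sub_cancel]
        ring
  push_cast at hfin
  rw [mul_pow] at hfin
  have hx1 := le_of_mul_le_mul_right hfin (by positivity)
  have hx2 : (x : ℤ) ^ 2 ≤ (x : ℤ) ^ (k - 1) :=
    pow_le_pow_right₀ (by exact_mod_cast hx) (by omega)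
  have := hx2.trans hx1
  rw [← Int.natCast_natAbs] at this
  exact_mod_cast this

/-- A finite bipartite graph without 4-cycles has at most `|T| + |S|²` edges. -/
theorem card_le_of_no_rectangle (P : Finset (ℕ × ℕ)) (S T : Finset ℕ)
    (hS : ∀ p ∈ P, p.1 ∈ S) (hT : ∀ p ∈ P, p.2 ∈ T)
    (hP : ∀ a a' b b', a < a' → b < b' →
      (a, b) ∈ P → (a, b') ∈ P → (a', b) ∈ P → (a', b') ∈ P → False) :
    P.card ≤ T.card + S.card ^ 2 := by
  classical
  have hr : ∀ b : ℕ, ∃ a : ℕ, (∃ p ∈ P, p.2 = b) → (a, b) ∈ P := by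
    intro b
    by_cases h : ∃ p ∈ P, p.2 = b
    · obtain ⟨p, hp, rfl⟩ := h
      exact ⟨p.1, fun _ => hp⟩
    · exact ⟨0, fun h' => (h h').elim⟩
  choose r hr using hr
  have hrep : ∀ p ∈ P, (r p.2, p.2) ∈ P := fun p hp => hr _ ⟨p, hp, rfl⟩
  rw [← Finset.card_filter_add_card_filter_not (fun p : ℕ × ℕ => p.1 = r p.2), sq,
    ← Finset.card_product]
  refine Nat.add_le_add ?_ ?_
  · refine Finset.card_le_card_of_injOn Prod.snd ?_ ?_
    · intro p hp
      simp only [Finset.coe_filter, Set.mem_ofPred_eq] at hp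
      exact hT p hp.1
    · intro p hp q hq hpq
      simp only [Finset.coe_filter, Set.mem_ofPred_eq] at hp hq
      exact Prod.ext (by rw [hp.2, hq.2, hpq]) hpq
  · refine Finset.card_le_card_of_injOn (fun p : ℕ × ℕ => (p.1, r p.2)) ?_ ?_
    · intro p hp
      simp only [Finset.coe_filter, Set.mem_ofPred_eq] at hp
      simp only [Finset.coe_product, Set.mem_prod, Finset.mem_coe]
      exact ⟨hS p hp.1, hS _ (hrep p hp.1)⟩
    · rintro ⟨a, b⟩ hp ⟨a', b'⟩ hq hpq
      simp only [Finset.coe_filter, Set.mem_ofPred_eq] at hp hq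
      simp only [Prod.mk.injEq] at hpq
      obtain ⟨rfl, hrr⟩ := hpq
      have h1 := hrep _ hp.1
      have h2 := hrep _ hq.1
      simp only at h1 h2
      rw [← hrr] at h2
      by_contra hne
      have hbb : b ≠ b' := fun h => hne (by rw [h])
      rcases lt_or_gt_of_ne hp.2 with h | h <;> rcases lt_or_gt_of_ne hbb with h' | h'
      · exact hP _ _ _ _ h h' hp.1 hq.1 h1 h2
      · exact hP _ _ _ _ h h' hq.1 hp.1 h2 h1
      · exact hP _ _ _ _ h h' h1 h2 hp.1 hq.1
      · exact hP _ _ _ _ h h' h2 h1 hq.1 hp.1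

open Classical in
/-- If `A` has at least two elements and the products `a * b` are shifted `k`-th powers outside
a negligible set, then `B` has `o(N)` elements up to `N ^ k`. -/
theorem factor_sparse {k : ℕ} (hk : 3 ≤ k) {n : ℤ} (hn : n ≠ 0) {E A B : Set ℕ}
    (hE : ∀ c m : ℕ, ∃ N₀ : ℕ, ∀ N ≥ N₀,
      m * ((Finset.range (c * N ^ k + 1)).filter (· ∈ E)).card ≤ N)
    (hA0 : ∀ a ∈ A, 0 < a) (hA : A.Nontrivial)
    (hAB : ∀ a ∈ A, ∀ b ∈ B, a * b ∉ E → ∃ x : ℕ, 0 < x ∧ (a * b : ℤ) = x ^ k + n) (m : ℕ) :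
    ∃ N₀ : ℕ, ∀ N ≥ N₀, m * ((Finset.range (N ^ k + 1)).filter (· ∈ B)).card ≤ N := by
  obtain ⟨a₁, ha₁, a₂, ha₂, hlt⟩ := hA.exists_lt
  set q := 4 * (m + 1) with hq
  obtain ⟨N₁, hN₁⟩ := hE a₁ q
  obtain ⟨N₂, hN₂⟩ := hE a₂ q
  refine ⟨N₁ + N₂ + 8 * m + 8 + 2 * n.natAbs ^ 2 * (a₂ + n.natAbs) * q ^ 2 + 1, fun N hN => ?_⟩
  have e₁ := hN₁ N (by omega)
  have e₂ := hN₂ N (by omega)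
  have hx : ∀ b : ℕ, ∃ x : ℕ, b ∈ B → a₁ * b ∉ E → 0 < x ∧ (a₁ * b : ℤ) = x ^ k + n := by
    intro b
    by_cases h : b ∈ B ∧ a₁ * b ∉ E
    · obtain ⟨x, hx⟩ := hAB a₁ ha₁ b h.1 h.2
      exact ⟨x, fun _ _ => hx⟩
    · exact ⟨0, fun h1 h2 => (h ⟨h1, h2⟩).elim⟩
  choose x hx using hx
  set S := (Finset.range (N ^ k + 1)).filter (· ∈ B) with hS
  have hbad : ∀ a ∈ A, (S.filter (fun b => a * b ∈ E)).card ≤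
      ((Finset.range (a * N ^ k + 1)).filter (· ∈ E)).card := by
    intro a ha
    refine Finset.card_le_card_of_injOn (fun b => a * b) ?_ ?_
    · intro b hb
      simp only [hS, Finset.coe_filter, Finset.mem_filter, Finset.mem_range, Set.mem_ofPred_eq]
        at hb ⊢
      exact ⟨Nat.lt_succ_of_le (Nat.mul_le_mul_left _ (Nat.le_of_lt_succ hb.1.1)), hb.2⟩
    · intro b _ c _ h
      exact Nat.eq_of_mul_eq_mul_left (hA0 a ha) h
  set G := S.filter (fun b => a₁ * b ∉ E ∧ a₂ * b ∉ E) with hG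
  have hGx : ∀ b ∈ G, 0 < x b ∧ (a₁ * b : ℤ) = (x b : ℤ) ^ k + n := by
    intro b hb
    simp only [hG, hS, Finset.mem_filter] at hb
    exact hx b hb.1.2 hb.2.1
  have hG1 : (G.filter (fun b => q * x b ≤ N)).card ≤ N / q + 1 := by
    rw [← Finset.card_range (N / q + 1)]
    refine Finset.card_le_card_of_injOn x ?_ ?_
    · intro b hb
      simp only [Finset.coe_filter, Set.mem_ofPred_eq, Finset.coe_range, Set.mem_Iio] at hb ⊢
      exact Nat.lt_succ_of_le ((Nat.le_div_iff_mul_le (by omega)).2 (by linarith [hb.2]))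
    · intro b hb c hc h
      simp only [Finset.coe_filter, Set.mem_ofPred_eq] at hb hc
      have h1 := (hGx b hb.1).2
      rw [h, ← (hGx c hc.1).2] at h1
      exact Nat.eq_of_mul_eq_mul_left (hA0 a₁ ha₁) (by exact_mod_cast h1)
  have hG2 : (G.filter (fun b => ¬ q * x b ≤ N)).card ≤ 1 := by
    have key : ∀ b c, b ∈ G → c ∈ G → ¬ q * x b ≤ N → b < c → False := by
      intro b c hb hc hxb hbc
      have hb' := hb
      have hc' := hc
      simp only [hG, hS, Finset.mem_filter, Finset.mem_range] at hb' hc'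
      obtain ⟨z, hz, hz'⟩ := hAB a₂ ha₂ b hb'.1.2 hb'.2.2
      obtain ⟨w, hw, hw'⟩ := hAB a₂ ha₂ c hc'.1.2 hc'.2.2
      have h := sq_le_of_rectangle hk hn hlt hbc (hGx b hb).1 hw (hGx b hb).2 (hGx c hc).2 hz' hw'
      have hwN : w ≤ (a₂ + n.natAbs) * N := by
        have hN1 : 1 ≤ N := by omega
        refine le_of_pow_le_pow_left₀ (n := k) (by omega) (Nat.zero_le _) ?_
        have h1 : w ^ k ≤ a₂ * c + n.natAbs := by
          zify
          have := neg_abs_le n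
          linarith
        have h2 : 1 ≤ N ^ k := Nat.one_le_pow _ _ hN1
        calc w ^ k ≤ a₂ * c + n.natAbs := h1
          _ ≤ a₂ * N ^ k + n.natAbs * N ^ k := by
            gcongr
            · omega
            · exact Nat.le_mul_of_pos_right _ h2
          _ = (a₂ + n.natAbs) * N ^ k := by ring
          _ ≤ (a₂ + n.natAbs) ^ k * N ^ k := by
            gcongr
            exact Nat.le_self_pow (by omega) _
          _ = _ := (mul_pow _ _ _).symm
      push Not at hxb
      have h3 : N ^ 2 < (q * x b) ^ 2 := by gcongr
      have h4 : (q * x b) ^ 2 ≤ (2 * n.natAbs ^ 2 * (a₂ + n.natAbs) * q ^ 2) * N := by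
        calc (q * x b) ^ 2 = q ^ 2 * x b ^ 2 := by ring
          _ ≤ q ^ 2 * (2 * n.natAbs ^ 2 * ((a₂ + n.natAbs) * N)) := by
            gcongr
            exact h.trans (by gcongr)
          _ = _ := by ring
      have h5 : (2 * n.natAbs ^ 2 * (a₂ + n.natAbs) * q ^ 2) * N ≤ N * N := by
        gcongr
        omega
      nlinarith
    rw [Finset.card_le_one]
    intro b hb c hc
    simp only [Finset.mem_filter] at hb hc
    by_contra hne
    rcases lt_or_gt_of_ne hne with h | h
    · exact key b c hb.1 hc.1 hb.2 h
    · exact key c b hc.1 hb.1 hc.2 h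
  have hG12 := Finset.card_filter_add_card_filter_not (s := G) (fun b => q * x b ≤ N)
  have hcover : S.card ≤ (S.filter (fun b => a₁ * b ∈ E)).card +
      (S.filter (fun b => a₂ * b ∈ E)).card + G.card := by
    refine (Finset.card_le_card ?_).trans
      ((Finset.card_union_le _ _).trans (Nat.add_le_add_right (Finset.card_union_le _ _) _))
    intro b hb
    simp only [hG, Finset.mem_union, Finset.mem_filter]
    tauto
  have b₁ := hbad a₁ ha₁
  have b₂ := hbad a₂ ha₂
  have hdiv : q * (N / q) ≤ N := Nat.mul_div_le _ _
  have htot : q * S.card ≤ 3 * N + 2 * q := by nlinarith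
  have hN8 : 8 * m + 8 ≤ N := by omega
  rw [hq] at htot
  linarith [Nat.zero_le S.card]

open Classical in
/-- Pairs of factors with small first factor and product a shifted `k`-th power with root in
the upper half of `[1, L ^ 2]` are few. -/
theorem card_pairs_le {k : ℕ} (hk : 3 ≤ k) {n : ℤ} (hn : n ≠ 0) {A B : Set ℕ} {L : ℕ}
    (hL : 8 * n.natAbs ^ 2 < L ^ 2) (T : Finset ℕ) (f g : ℕ → ℕ)
    (hT : ∀ x ∈ T, L ^ 2 < 2 * x ∧ x ≤ L ^ 2 ∧ f x ∈ A ∧ g x ∈ B ∧ f x ≤ L ^ k ∧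
      g x ≤ (L ^ 2) ^ k ∧ (f x * g x : ℤ) = x ^ k + n) :
    T.card ≤ ((Finset.range ((L ^ 2) ^ k + 1)).filter (· ∈ B)).card +
      ((Finset.range (L ^ k + 1)).filter (· ∈ A)).card ^ 2 := by
  have hinj : Set.InjOn (fun x => (f x, g x)) (T : Set ℕ) := by
    intro x hx y hy h
    simp only [Prod.mk.injEq] at h
    have h1 := (hT x hx).2.2.2.2.2.2
    rw [h.1, h.2, (hT y hy).2.2.2.2.2.2] at h1
    have h2 : y ^ k = x ^ k := by exact_mod_cast add_right_cancel h1
    exact (Nat.pow_left_injective (by omega : k ≠ 0) h2).symm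
  rw [← Finset.card_image_of_injOn hinj]
  apply card_le_of_no_rectangle
  · intro p hp
    obtain ⟨x, hx, rfl⟩ := Finset.mem_image.1 hp
    have := hT x hx
    simp only [Finset.mem_filter, Finset.mem_range]
    exact ⟨by omega, this.2.2.1⟩
  · intro p hp
    obtain ⟨x, hx, rfl⟩ := Finset.mem_image.1 hp
    have := hT x hx
    simp only [Finset.mem_filter, Finset.mem_range]
    exact ⟨by omega, this.2.2.2.1⟩
  · intro a a' b b' ha hb h1 h2 h3 h4
    have key : ∀ a b, (a, b) ∈ T.image (fun x => (f x, g x)) →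
        ∃ x : ℕ, L ^ 2 < 2 * x ∧ x ≤ L ^ 2 ∧ (a * b : ℤ) = x ^ k + n := by
      intro a b h
      obtain ⟨x, hx, he⟩ := Finset.mem_image.1 h
      simp only [Prod.mk.injEq] at he
      obtain ⟨rfl, rfl⟩ := he
      have := hT x hx
      exact ⟨x, this.1, this.2.1, this.2.2.2.2.2.2⟩
    obtain ⟨x, hx, -, ex⟩ := key _ _ h1
    obtain ⟨y, -, -, ey⟩ := key _ _ h2
    obtain ⟨z, -, -, ez⟩ := key _ _ h3
    obtain ⟨w, hw, hw', ew⟩ := key _ _ h4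
    have h := sq_le_of_rectangle hk hn ha hb (by omega) (by omega) ex ey ez ew
    have h5 : 2 * n.natAbs ^ 2 * w ≤ 2 * n.natAbs ^ 2 * L ^ 2 := by gcongr
    nlinarith

open Classical in
/-- Integer form of the smallness hypothesis. -/
theorem card_range_filter_mul_le {k : ℕ} (hk : k ≠ 0) {E : Set ℕ}
    (hsmall : ∀ ε : ℝ, 0 < ε → ∃ X₀ : ℝ, ∀ X : ℝ, X₀ ≤ X →
      ((Set.ncard {x ∈ E | (x : ℝ) ≤ X} : ℝ)) ≤ ε * X ^ ((1 : ℝ) / k)) (c m : ℕ) :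
    ∃ N₀ : ℕ, ∀ N ≥ N₀, m * ((Finset.range (c * N ^ k + 1)).filter (· ∈ E)).card ≤ N := by
  obtain ⟨X₀, hX₀⟩ := hsmall (1 / ((m + 1) * (c + 1))) (by positivity)
  refine ⟨⌈X₀⌉₊, fun N hN => ?_⟩
  have hXN : X₀ ≤ (((c + 1) * N : ℕ) : ℝ) ^ k := by
    have h1 : N ≤ ((c + 1) * N) ^ k :=
      (Nat.le_mul_of_pos_left _ (Nat.succ_pos c)).trans (Nat.le_self_pow hk _)
    calc X₀ ≤ N := Nat.ceil_le.1 hN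
      _ ≤ _ := by exact_mod_cast h1
  have h := hX₀ _ hXN
  rw [one_div (k : ℝ), Real.pow_rpow_inv_natCast (Nat.cast_nonneg _) hk] at h
  have hsub : ((Finset.range (c * N ^ k + 1)).filter (· ∈ E)).card ≤
      Set.ncard {x ∈ E | (x : ℝ) ≤ (((c + 1) * N : ℕ) : ℝ) ^ k} := by
    rw [← Set.ncard_coe_finset]
    refine Set.ncard_le_ncard ?_ ?_
    · intro x hx
      simp only [Finset.coe_filter, Finset.mem_range, Set.mem_ofPred_eq] at hx ⊢
      refine ⟨hx.2, ?_⟩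
      have : x ≤ ((c + 1) * N) ^ k := by
        calc x ≤ c * N ^ k := by omega
          _ ≤ (c + 1) ^ k * N ^ k := by
            gcongr
            exact (Nat.le_succ c).trans (Nat.le_self_pow hk _)
          _ = _ := (mul_pow _ _ _).symm
      exact_mod_cast this
    · refine (Set.finite_Iic (((c + 1) * N) ^ k)).subset ?_
      intro x hx
      exact_mod_cast hx.2
  have h2 : (m + 1 : ℝ) * Set.ncard {x ∈ E | (x : ℝ) ≤ (((c + 1) * N : ℕ) : ℝ) ^ k} ≤ N := by
    calc _ ≤ (m + 1 : ℝ) * (1 / ((m + 1) * (c + 1)) * (((c + 1) * N : ℕ) : ℝ)) := by gcongr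
      _ = N := by
        push_cast
        field_simp
  have h3 : (m + 1) * Set.ncard {x ∈ E | (x : ℝ) ≤ (((c + 1) * N : ℕ) : ℝ) ^ k} ≤ N := by
    exact_mod_cast h2
  exact (Nat.mul_le_mul (Nat.le_succ m) hsub).trans h3

/-- Theorem 1.3: if `R` differs from `{x^k + n : x ∈ ℕ} ∩ ℕ` by `o(X^{1/k})` elements
up to `X`, then `R` is multiplicatively irreducible. -/
theorem perturbed_shifted_powers_mult_irreducible
    (k : ℕ) (n : ℤ) (hk : 3 ≤ k) (hn : n ≠ 0)
    (M : Set ℕ)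
    (hM : M = {m : ℕ | 0 < m ∧ ∃ x : ℕ, 0 < x ∧ (m : ℤ) = (x : ℤ) ^ k + n})
    (R : Set ℕ) (hRpos : ∀ r ∈ R, 0 < r)
    (hsmall : ∀ ε : ℝ, 0 < ε → ∃ X₀ : ℝ, ∀ X : ℝ, X₀ ≤ X →
      ((Set.ncard {x ∈ symmDiff R M | (x : ℝ) ≤ X} : ℝ)) ≤ ε * X ^ ((1 : ℝ) / k)) :
    ¬ ∃ A B : Set ℕ, (∀ a ∈ A, 0 < a) ∧ (∀ b ∈ B, 0 < b) ∧
      A.Nontrivial ∧ B.Nontrivial ∧ R = A * B := by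
  classical
  rintro ⟨A, B, hA0, hB0, hA, hB, hR⟩
  have hE := card_range_filter_mul_le (by omega) hsmall
  have hAB : ∀ a ∈ A, ∀ b ∈ B, a * b ∉ symmDiff R M →
      ∃ x : ℕ, 0 < x ∧ (a * b : ℤ) = x ^ k + n := by
    intro a ha b hb h
    have hr : a * b ∈ R := hR ▸ Set.mul_mem_mul ha hb
    have hm : a * b ∈ M := by
      by_contra hm
      exact h (Or.inl ⟨hr, hm⟩)
    rw [hM] at hm
    obtain ⟨-, x, hx, h⟩ := hm
    exact ⟨x, hx, by exact_mod_cast h⟩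
  have hBA : ∀ b ∈ B, ∀ a ∈ A, b * a ∉ symmDiff R M →
      ∃ x : ℕ, 0 < x ∧ (b * a : ℤ) = x ^ k + n := by
    intro b hb a ha h
    rw [mul_comm] at h ⊢
    exact hAB a ha b hb h
  obtain ⟨N₁, hN₁⟩ := factor_sparse hk hn hE hA0 hA hAB 100
  obtain ⟨N₂, hN₂⟩ := factor_sparse hk hn hE hB0 hB hBA 100
  obtain ⟨N₃, hN₃⟩ := hE 1 100
  obtain ⟨L, hL⟩ : ∃ L, L = N₁ + N₂ + N₃ + 8 * n.natAbs ^ 2 + 10 * n.natAbs + 10 := ⟨_, rfl⟩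
  have hLL : 10 * L ≤ L ^ 2 := by
    rw [sq]
    exact Nat.mul_le_mul_right L (by omega)
  have hBL := hN₁ L (by omega)
  have hBN := hN₁ (L ^ 2) (by nlinarith)
  have hAL := hN₂ L (by omega)
  have hAN := hN₂ (L ^ 2) (by nlinarith)
  have hEN := hN₃ (L ^ 2) (by nlinarith)
  rw [one_mul] at hEN
  have hL8 : 8 * n.natAbs ^ 2 < L ^ 2 := by nlinarith
  set U := Finset.Icc (L ^ 2 / 2 + 1) (L ^ 2 - n.natAbs) with hU
  have hUcard : U.card = L ^ 2 - n.natAbs - L ^ 2 / 2 := by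
    rw [hU, Nat.card_Icc]; omega
  -- the value `x ^ k + n` as a natural number
  have hval : ∀ x ∈ U, ((((x : ℤ) ^ k + n).toNat : ℕ) : ℤ) = x ^ k + n ∧
      ((x : ℤ) ^ k + n).toNat ∈ M ∧ ((x : ℤ) ^ k + n).toNat ≤ (L ^ 2) ^ k := by
    intro x hx
    rw [hU, Finset.mem_Icc] at hx
    have hxn : n.natAbs < x := by omega
    have h1 : x ≤ x ^ k := Nat.le_self_pow (by omega) x
    have h2 : (0 : ℤ) < (x : ℤ) ^ k + n := by
      have : (x : ℤ) ≤ (x : ℤ) ^ k := by exact_mod_cast h1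
      omega
    have h3 := Int.toNat_of_nonneg h2.le
    refine ⟨h3, ?_, ?_⟩
    · rw [hM]
      exact ⟨by omega, x, by omega, h3⟩
    · have h4 : x ^ k + n.natAbs ≤ (L ^ 2) ^ k := by
        calc x ^ k + n.natAbs ≤ x ^ k + n.natAbs ^ k := by
              gcongr
              exact Nat.le_self_pow (by omega) _
          _ ≤ (x + n.natAbs) ^ k := pow_add_pow_le (Nat.zero_le _) (Nat.zero_le _) (by omega)
          _ ≤ (L ^ 2) ^ k := by
              gcongr
              omega
      have h5 : ((x ^ k + n.natAbs : ℕ) : ℤ) ≤ ((L ^ 2) ^ k : ℕ) := by exact_mod_cast h4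
      have h6 := neg_abs_le n
      push_cast at h5
      zify
      rw [h3]
      linarith [le_abs_self n]
  set V := U.filter (fun x : ℕ => ((x : ℤ) ^ k + n).toNat ∈ R) with hV
  have hUV : (U.filter (fun x : ℕ => ¬ ((x : ℤ) ^ k + n).toNat ∈ R)).card ≤
      ((Finset.range ((L ^ 2) ^ k + 1)).filter (· ∈ symmDiff R M)).card := by
    refine Finset.card_le_card_of_injOn (fun x : ℕ => ((x : ℤ) ^ k + n).toNat) ?_ ?_
    · intro x hx
      simp only [Finset.coe_filter, Set.mem_ofPred_eq, Finset.mem_range] at hx ⊢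
      obtain ⟨-, h2, h3⟩ := hval x hx.1
      exact ⟨by omega, Or.inr ⟨h2, hx.2⟩⟩
    · intro x hx y hy h
      simp only [Finset.coe_filter, Set.mem_ofPred_eq] at hx hy h
      have h1 := (hval x hx.1).1
      rw [h, (hval y hy.1).1] at h1
      have h2 : y ^ k = x ^ k := by exact_mod_cast add_right_cancel h1
      exact (Nat.pow_left_injective (by omega : k ≠ 0) h2).symm
  have hsplit := Finset.card_filter_add_card_filter_not (s := U)
    (fun x : ℕ => ((x : ℤ) ^ k + n).toNat ∈ R)
  have hfac : ∀ x : ℕ, ∃ p : ℕ × ℕ, x ∈ V → p.1 ∈ A ∧ p.2 ∈ B ∧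
      p.1 * p.2 = ((x : ℤ) ^ k + n).toNat := by
    intro x
    by_cases h : x ∈ V
    · have h' := (Finset.mem_filter.1 h).2
      rw [hR] at h'
      obtain ⟨a, ha, b, hb, hab⟩ := Set.mem_mul.1 h'
      exact ⟨(a, b), fun _ => ⟨ha, hb, hab⟩⟩
    · exact ⟨(0, 0), fun h' => (h h').elim⟩
  choose p hp using hfac
  have hfacts : ∀ x ∈ V, L ^ 2 < 2 * x ∧ x ≤ L ^ 2 ∧ (p x).1 ∈ A ∧ (p x).2 ∈ B ∧
      (p x).1 ≤ (L ^ 2) ^ k ∧ (p x).2 ≤ (L ^ 2) ^ k ∧ (p x).1 * (p x).2 ≤ (L ^ 2) ^ k ∧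
      ((p x).1 * (p x).2 : ℤ) = x ^ k + n := by
    intro x hx
    have hxU := (Finset.mem_filter.1 hx).1
    obtain ⟨h1, -, h3⟩ := hval x hxU
    obtain ⟨ha, hb, hab⟩ := hp x hx
    rw [← hab] at h1 h3
    rw [hU, Finset.mem_Icc] at hxU
    refine ⟨by omega, by omega, ha, hb, ?_, ?_, h3, by exact_mod_cast h1⟩
    · exact (Nat.le_mul_of_pos_right _ (hB0 _ hb)).trans h3
    · exact (Nat.le_mul_of_pos_left _ (hA0 _ ha)).trans h3
  have hV1 := card_pairs_le hk hn hL8 (A := A) (B := B) (V.filter (fun x => (p x).1 ≤ L ^ k))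
    (fun x => (p x).1) (fun x => (p x).2) (by
      intro x hx
      rw [Finset.mem_filter] at hx
      obtain ⟨h1, h2, h3, h4, -, h6, -, h8⟩ := hfacts x hx.1
      exact ⟨h1, h2, h3, h4, hx.2, h6, h8⟩)
  have hV2 := card_pairs_le hk hn hL8 (A := B) (B := A) (V.filter (fun x => ¬ (p x).1 ≤ L ^ k))
    (fun x => (p x).2) (fun x => (p x).1) (by
      intro x hx
      rw [Finset.mem_filter] at hx
      obtain ⟨h1, h2, h3, h4, h5, -, h7, h8⟩ := hfacts x hx.1
      refine ⟨h1, h2, h4, h3, ?_, h5, by rw [mul_comm]; exact h8⟩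
      by_contra hlt
      have h9 := Nat.mul_lt_mul'' (not_le.1 hx.2) (not_le.1 hlt)
      rw [← mul_pow, ← sq] at h9
      omega)
  have hVsplit := Finset.card_filter_add_card_filter_not (s := V) (fun x => (p x).1 ≤ L ^ k)
  have hA2 := Nat.pow_le_pow_left hAL 2
  have hB2 := Nat.pow_le_pow_left hBL 2
  rw [mul_pow] at hA2 hB2
  rw [← hV] at hsplit
  omega
end

section
/- Let k ≥ 3 be an integer and let n be a nonzero integer. Define s_3 = 6, s_4 = 4, s_5 = 3, and s_k = 2 for k ≥ 6; define t_3 = 15399/938, t_4 = 34/3, t_5 = 97/23, t_6 = 29/4, and t_k = (k² + k − 4)/(k² − 6k + 6) for k ≥ 7. Let A = {a₁, a₂, …, a_ℓ} and B = {b₁, b₂, …, b_m} be sets of positive integers with a₁ < a₂ < ⋯ < a_ℓ and b₁ < b₂ < ⋯ < b_m, such that ab + n is a k-th power of a positive integer for every a ∈ A and b ∈ B. If k > 3, assume m ≥ s_k + 1, ℓ ≥ 2, and a₂ ≤ b_{m − s_k}; if k = 3, assume m ≥ 7, ℓ ≥ 3, and a₃ ≤ b_{m − 6}. Then at most s_k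 elements of B are at least 2|n|^{t_k}. -/
/-- The constants `s_k`: `s_3 = 6`, `s_4 = 4`, `s_5 = 3`, and `s_k = 2` for `k ≥ 6`. -/
def sConst : ℕ → ℕ
  | 3 => 6
  | 4 => 4
  | 5 => 3
  | _ => 2

/-- The constants `t_k`: `t_3 = 15399/938`, `t_4 = 34/3`, `t_5 = 97/23`, `t_6 = 29/4`,
and `t_k = (k² + k − 4)/(k² − 6k + 6)` for `k ≥ 7`. -/
noncomputable def tConst : ℕ → ℝ
  | 3 => 15399 / 938
  | 4 => 34 / 3
  | 5 => 97 / 23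
  | 6 => 29 / 4
  | k => ((k : ℝ) ^ 2 + (k : ℝ) - 4) / ((k : ℝ) ^ 2 - 6 * (k : ℝ) + 6)

open Finset in
theorem prod_sub_eq_factorial_mul_choose (x : ℝ) (s : ℕ) :
    ∏ j ∈ range s, (x - j) = s.factorial * Ring.choose x s := by
  have h := Ring.descPochhammer_eq_factorial_smul_choose x s
  rw [nsmul_eq_mul, ← Polynomial.eval₂_smulOneHom_eq_smeval] at h
  rw [← h, ← descPochhammer_eval_eq_prod_range, ← descPochhammer_map (Int.castRingHom ℝ),
    Polynomial.eval_map]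
  congr 1
  exact RingHom.ext_int _ _

open Finset in
theorem sum_range_choose_mul_choose (x y : ℝ) (m : ℕ) :
    ∑ i ∈ range (m + 1), Ring.choose x i * Ring.choose y (m - i) = Ring.choose (x + y) m := by
  rw [Ring.add_choose_eq m (Commute.all x y),
    Nat.sum_antidiagonal_eq_sum_range_succ (fun i j => Ring.choose x i * Ring.choose y j)]

theorem choose_mul_choose_sub_comm (x : ℝ) (m s : ℕ) :
    Ring.choose x m * Ring.choose (x - m) s = Ring.choose x s * Ring.choose (x - s) m := by
  have h1 := Ring.choose_smul_choose x (Nat.le_add_right m s)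
  have h2 := Ring.choose_smul_choose x (Nat.le_add_left s m)
  rw [Nat.add_sub_cancel_left] at h1
  rw [Nat.add_sub_cancel] at h2
  rw [← h1, ← h2, Nat.choose_symm_add]

open Finset in
theorem sum_choose_mul_choose_mul_choose_shift (x y : ℝ) (r s : ℕ) :
    ∑ i ∈ range (r + 1), Ring.choose y i * Ring.choose x (r - i) * Ring.choose (x - r + i) s =
      Ring.choose x s * Ring.choose (x + y - s) r := by
  rw [show x + y - s = y + (x - s) by ring, ← sum_range_choose_mul_choose, mul_sum]
  refine sum_congr rfl fun i hi => ?_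
  have hi' : i ≤ r := Nat.lt_succ_iff.mp (mem_range.mp hi)
  have := choose_mul_choose_sub_comm x (r - i) s
  rw [Nat.cast_sub hi', show x - ((r : ℝ) - i) = x - r + i by ring] at this
  rw [mul_assoc, this]; ring

open Finset in
theorem sum_choose_mul_choose_mul_natChoose (x y : ℝ) {r s : ℕ} (hs : s ≤ r) :
    ∑ i ∈ range (r + 1), Ring.choose x i * Ring.choose y (r - i) * Ring.choose (i : ℝ) s =
      Ring.choose x s * Ring.choose (x + y - s) (r - s) := by
  rw [show x + y - s = (x - s) + y by ring, ← sum_range_choose_mul_choose, mul_sum]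
  rw [show r + 1 = s + (r - s + 1) by omega, sum_range_add, sum_eq_zero, zero_add]
  · refine sum_congr rfl fun i hi => ?_
    rw [Ring.choose_natCast, show r - (s + i) = r - s - i by omega]
    have := Ring.choose_smul_choose x (Nat.le_add_right s i)
    rw [Nat.add_sub_cancel_left, nsmul_eq_mul] at this
    rw [← mul_assoc, ← this]
    ring
  · intro i hi
    rw [Ring.choose_natCast, Nat.choose_eq_zero_of_lt (mem_range.mp hi)]; simp

open Finset in
theorem pade_taylor_coeff_eq (ν : ℝ) {r s : ℕ} (hs : s ≤ r) :
    ∑ i ∈ range (r + 1), Ring.choose ((r : ℝ) + ν) i * Ring.choose ((r : ℝ) - ν) (r - i) *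
        Ring.choose (i : ℝ) s =
      ∑ i ∈ range (r + 1), Ring.choose ((r : ℝ) - ν) i * Ring.choose ((r : ℝ) + ν) (r - i) *
        Ring.choose (ν + i) s := by
  have h1 := sum_choose_mul_choose_mul_choose_shift ((r : ℝ) + ν) ((r : ℝ) - ν) r s
  rw [sum_choose_mul_choose_mul_natChoose _ _ hs]
  simp only [add_sub_cancel_left] at h1
  rw [h1, show (r : ℝ) + ν + (r - ν) - s = ((2 * r - s : ℕ) : ℝ) by
    rw [Nat.cast_sub (by omega)]; push_cast; ring, Ring.choose_natCast, Ring.choose_natCast,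
    ← Nat.choose_symm (by omega : r - s ≤ 2 * r - s)]
  congr 4; omega

theorem factorial_dvd_pow_mul_prod (k i : ℕ) (c : ℤ) :
    (i.factorial : ℤ) ∣ (k : ℤ) ^ i * ∏ j ∈ Finset.range i, (c - j * k) := by
  rw [← Int.natAbs_dvd_natAbs, Int.natAbs_natCast, Nat.dvd_iff_prime_pow_dvd_dvd]
  intro p e hp he
  rw [← Int.natCast_dvd]
  by_cases hk : p ∣ k
  · have hle : e ≤ i := by
      have h1 := (hp.pow_dvd_iff_le_factorization (Nat.factorial_ne_zero i)).mp he
      have h2 := Nat.factorization_factorial_le_div_pred hp i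
      exact h1.trans (h2.trans (Nat.div_le_self _ _))
    refine Dvd.dvd.mul_right ?_ _
    exact_mod_cast (pow_dvd_pow p hle).trans (pow_dvd_pow_of_dvd hk i)
  · have hcop : IsCoprime ((p ^ e : ℕ) : ℤ) (k : ℤ) :=
      Nat.isCoprime_iff_coprime.mpr (((hp.coprime_iff_not_dvd).mpr hk).pow_left e)
    obtain ⟨u, v, huv⟩ := hcop
    have h1 : ((p ^ e : ℕ) : ℤ) ∣ ∏ j ∈ Finset.range i, (c * v - j) := by
      have : (i.factorial : ℤ) ∣ ∏ j ∈ Finset.range i, (c * v - j) := by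
        have h := Ring.descPochhammer_eq_factorial_smul_choose (c * v) i
        rw [← Polynomial.eval₂_smulOneHom_eq_smeval] at h
        refine ⟨Ring.choose (c * v) i, ?_⟩
        rw [← nsmul_eq_mul, ← h, ← descPochhammer_eval_eq_prod_range,
          show (RingHom.smulOneHom : ℤ →+* ℤ) = RingHom.id ℤ from RingHom.ext_int _ _,
          Polynomial.eval₂_id]
      exact (Int.natCast_dvd_natCast.mpr he).trans this
    refine Dvd.dvd.mul_left ?_ _
    have h2 : (k : ℤ) ^ i * ∏ j ∈ Finset.range i, (c * v - j) ≡
        ∏ j ∈ Finset.range i, (c - j * k) [ZMOD ((p ^ e : ℕ) : ℤ)] := by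
      rw [← Finset.card_range i, ← Finset.prod_const, Finset.card_range,
        ← Finset.prod_mul_distrib]
      refine Int.ModEq.prod fun j _ => ?_
      refine (Int.modEq_iff_dvd.mpr ⟨c * u, ?_⟩)
      linear_combination (-c) * huv
    exact h2.dvd_iff.mp (h1.mul_left _)

/-- The numerators of the Padé approximants of `w ^ ν` at `w = 1` have coefficients
`padeCoeff ν r i`, and the denominators have coefficients `padeCoeff (-ν) r i`. -/
noncomputable def padeCoeff (ν : ℝ) (r i : ℕ) : ℝ :=
  Ring.choose ((r : ℝ) + ν) i * Ring.choose ((r : ℝ) - ν) (r - i)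

theorem exists_int_choose_eq {k : ℕ} (hk : 0 < k) (c : ℤ) (i : ℕ) :
    ∃ z : ℤ, (z : ℝ) = (k : ℝ) ^ (2 * i) * Ring.choose ((c : ℝ) / k) i := by
  obtain ⟨z, hz⟩ := factorial_dvd_pow_mul_prod k i c
  refine ⟨z, ?_⟩
  have hf : (i.factorial : ℝ) ≠ 0 := by positivity
  apply mul_left_cancel₀ hf
  have h : ((i.factorial : ℤ) * z : ℝ) = (k : ℝ) ^ i * ∏ j ∈ Finset.range i, ((c : ℝ) - j * k) := by
    exact_mod_cast hz.symm
  have hk' : (k : ℝ) ≠ 0 := by positivity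
  have h2 : ∏ j ∈ Finset.range i, ((c : ℝ) - j * k) =
      (k : ℝ) ^ i * ∏ j ∈ Finset.range i, ((c : ℝ) / k - j) := by
    conv_rhs => rw [← Finset.card_range i, ← Finset.prod_const, Finset.card_range,
        ← Finset.prod_mul_distrib]
    refine Finset.prod_congr rfl fun j _ => ?_
    field_simp
  rw [h2, prod_sub_eq_factorial_mul_choose] at h
  push_cast at h
  rw [h]; ring

theorem exists_int_padeCoeff_eq {k : ℕ} (hk : 0 < k) {r i : ℕ} (hi : i ≤ r) {ν : ℝ}
    (hν : ν = 1 / k ∨ ν = -(1 / k)) :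
    ∃ z : ℤ, (z : ℝ) = (k : ℝ) ^ (2 * r) * padeCoeff ν r i := by
  have hk' : (k : ℝ) ≠ 0 := by positivity
  obtain ⟨c, hc⟩ : ∃ c : ℤ, (c : ℝ) / k = ν := by
    rcases hν with rfl | rfl
    · exact ⟨1, by simp⟩
    · exact ⟨-1, by simp [neg_div]⟩
  obtain ⟨z₁, h₁⟩ := exists_int_choose_eq hk (r * k + c) i
  obtain ⟨z₂, h₂⟩ := exists_int_choose_eq hk (r * k - c) (r - i)
  refine ⟨z₁ * z₂, ?_⟩
  push_cast at h₁ h₂ ⊢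
  rw [h₁, h₂, padeCoeff, add_div, sub_div, mul_div_assoc, div_self hk', mul_one, hc,
    show 2 * r = 2 * i + 2 * (r - i) by omega, pow_add]
  ring

theorem choose_nonneg_of_lt {x : ℝ} {i : ℕ} (h : (i : ℝ) < x + 1) : 0 ≤ Ring.choose x i := by
  have h1 := prod_sub_eq_factorial_mul_choose x i
  have h2 : 0 ≤ ∏ j ∈ Finset.range i, (x - j) := by
    refine Finset.prod_nonneg fun j hj => ?_
    have : (j : ℝ) + 1 ≤ i := by exact_mod_cast Finset.mem_range.mp hj
    linarith
  rw [h1] at h2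
  exact nonneg_of_mul_nonneg_right h2 (by positivity)

theorem padeCoeff_nonneg {ν : ℝ} (h1 : -1 < ν) (h2 : ν < 1) {r i : ℕ} (hi : i ≤ r) :
    0 ≤ padeCoeff ν r i := by
  have hi' : (i : ℝ) ≤ r := by exact_mod_cast hi
  refine mul_nonneg (choose_nonneg_of_lt (by linarith)) (choose_nonneg_of_lt ?_)
  rw [Nat.cast_sub hi]
  have : (0 : ℝ) ≤ i := i.cast_nonneg
  linarith

theorem sum_padeCoeff (ν : ℝ) (r : ℕ) :
    ∑ i ∈ Finset.range (r + 1), padeCoeff ν r i = (r.centralBinom : ℝ) := by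
  simp only [padeCoeff]
  rw [sum_range_choose_mul_choose, show (r : ℝ) + ν + (r - ν) = ((2 * r : ℕ) : ℝ) by
    push_cast; ring, Ring.choose_natCast, Nat.centralBinom]

open Finset in
theorem padeCoeff_neg_mul_prod (ν : ℝ) {r i : ℕ} (hi : i ≤ r) :
    padeCoeff (-ν) r i * ∏ j ∈ range (r + 1), (ν + i - j) =
      (∏ j ∈ range (r + 1), (ν + j)) * (∏ j ∈ range r, (j + 1 - ν)) / r.factorial *
        ((r.choose i : ℝ) * (-1) ^ (r - i)) := by
  have e1 := prod_sub_eq_factorial_mul_choose ((r : ℝ) - ν) i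
  have e2 := prod_sub_eq_factorial_mul_choose ((r : ℝ) + ν) (r - i)
  have f1 : ∏ j ∈ range (r + 1), (ν + j) =
      (∏ j ∈ range (i + 1), (ν + i - j)) * ∏ j ∈ range (r - i), ((r : ℝ) + ν - j) := by
    rw [show r + 1 = (i + 1) + (r - i) by omega, prod_range_add,
      ← prod_range_reflect (fun j => ν + (j : ℝ)), ← prod_range_reflect _ (r - i)]
    congr 1
    · refine prod_congr rfl fun j hj => ?_
      have := mem_range.mp hj
      rw [show i + 1 - 1 - j = i - j by omega, Nat.cast_sub (by omega)]; ring
    · refine prod_congr rfl fun j hj => ?_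
      have := mem_range.mp hj
      rw [show i + 1 + (r - i - 1 - j) = r - j by omega, Nat.cast_sub (by omega)]; ring
  have f2 : ∏ j ∈ range r, ((j : ℝ) + 1 - ν) =
      (∏ j ∈ range (r - i), ((j : ℝ) + 1 - ν)) * ∏ j ∈ range i, ((r : ℝ) - ν - j) := by
    rw [show range r = range (r - i + i) by rw [Nat.sub_add_cancel hi], prod_range_add,
      ← prod_range_reflect _ i]
    congr 1
    refine prod_congr rfl fun j hj => ?_
    have := mem_range.mp hj
    rw [show r - i + (i - 1 - j) = r - (j + 1) by omega, Nat.cast_sub (by omega)]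
    push_cast; ring
  have f3 : ∏ j ∈ range (r + 1), (ν + i - j) =
      (∏ j ∈ range (i + 1), (ν + i - j)) *
        ((-1) ^ (r - i) * ∏ j ∈ range (r - i), ((j : ℝ) + 1 - ν)) := by
    rw [show r + 1 = (i + 1) + (r - i) by omega, prod_range_add]
    congr 1
    conv_rhs => rw [← card_range (r - i), ← prod_const, card_range, ← prod_mul_distrib]
    refine prod_congr rfl fun j _ => ?_
    push_cast; ring
  have hc : (r.choose i : ℝ) * i.factorial * (r - i).factorial = r.factorial := by
    exact_mod_cast Nat.choose_mul_factorial_mul_factorial hi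
  rw [f1, f2, f3, e1, e2, padeCoeff, sub_neg_eq_add, ← sub_eq_add_neg]
  have hr : (r.factorial : ℝ) ≠ 0 := by positivity
  field_simp
  rw [← hc]; ring

open Finset in
/-- The `s`-th derivative of the error `∑ bᵢ t ^ (ν + i) - ∑ aᵢ t ^ i` of the Padé
approximation of `t ^ ν` at `t = 1`. -/
noncomputable def padeError (ν : ℝ) (r s : ℕ) (t : ℝ) : ℝ :=
  ∑ i ∈ range (r + 1),
    (padeCoeff (-ν) r i * (∏ j ∈ range s, (ν + i - j)) * t ^ (ν + i - s) -
      padeCoeff ν r i * (∏ j ∈ range s, ((i : ℝ) - j)) * t ^ ((i : ℝ) - s))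

theorem hasDerivAt_padeError (ν : ℝ) (r s : ℕ) {t : ℝ} (ht : 0 < t) :
    HasDerivAt (padeError ν r s) (padeError ν r (s + 1) t) t := by
  unfold padeError
  refine HasDerivAt.fun_sum fun i _ => ?_
  have key : ∀ c x : ℝ, HasDerivAt (fun t : ℝ => c * (∏ j ∈ Finset.range s, (x - j)) * t ^ (x - s))
      (c * (∏ j ∈ Finset.range (s + 1), (x - j)) * t ^ (x - (s + 1 : ℕ))) t := by
    intro c x
    have := (Real.hasDerivAt_rpow_const (x := t) (p := x - s) (Or.inl ht.ne')).const_mul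
      (c * (∏ j ∈ Finset.range s, (x - j)))
    refine this.congr_deriv ?_
    rw [Finset.prod_range_succ, show x - ((s + 1 : ℕ) : ℝ) = x - s - 1 by push_cast; ring]
    ring
  exact (key _ _).sub (key _ _)

theorem padeError_one (ν : ℝ) {r s : ℕ} (hs : s ≤ r) : padeError ν r s 1 = 0 := by
  have h := pade_taylor_coeff_eq ν hs
  simp only [padeError, Real.one_rpow, mul_one, prod_sub_eq_factorial_mul_choose,
    Finset.sum_sub_distrib]
  rw [sub_eq_zero]
  have h1 : ∀ (c d : ℕ → ℝ), ∑ i ∈ Finset.range (r + 1), c i * (s.factorial * d i) =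
      s.factorial * ∑ i ∈ Finset.range (r + 1), c i * d i := by
    intro c d
    rw [Finset.mul_sum]
    exact Finset.sum_congr rfl fun i _ => by ring
  rw [h1, h1]
  congr 1
  simp only [padeCoeff, sub_neg_eq_add, ← sub_eq_add_neg]
  exact h.symm

open Finset in
theorem padeError_succ_self (ν : ℝ) (r : ℕ) {t : ℝ} (ht : 0 < t) :
    padeError ν r (r + 1) t =
      (∏ j ∈ range (r + 1), (ν + j)) * (∏ j ∈ range r, (j + 1 - ν)) / r.factorial *
        ((t - 1) ^ r * t ^ (ν - r - 1)) := by
  have h : (t - 1) ^ r = ∑ i ∈ range (r + 1), t ^ i * (-1) ^ (r - i) * (r.choose i : ℝ) := by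
    rw [sub_eq_add_neg, add_pow]
  rw [h, sum_mul, mul_sum, padeError]
  refine sum_congr rfl fun i hi => ?_
  have hi' := Nat.lt_succ_iff.mp (mem_range.mp hi)
  have hz : ∏ j ∈ range (r + 1), ((i : ℝ) - j) = 0 := prod_eq_zero hi (sub_self _)
  rw [padeCoeff_neg_mul_prod ν hi', hz,
    show ν + i - ((r + 1 : ℕ) : ℝ) = i + (ν - r - 1) by push_cast; ring,
    Real.rpow_add ht, Real.rpow_natCast]
  ring

theorem le_of_le_hasDerivAt {f f' : ℝ → ℝ} {w c : ℝ} {p : ℕ} (hf1 : f 1 = 0)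
    (hf : ∀ t, 0 < t → HasDerivAt f (f' t) t)
    (hle : ∀ t ∈ Set.Icc 1 w, c * (t - 1) ^ p ≤ f' t) :
    ∀ t ∈ Set.Icc 1 w, c / (p + 1) * (t - 1) ^ (p + 1) ≤ f t := by
  have hd : ∀ t, 0 < t → HasDerivAt (fun t => f t - c / (p + 1) * (t - 1) ^ (p + 1))
      (f' t - c * (t - 1) ^ p) t := by
    intro t ht
    have := (((hasDerivAt_id t).sub_const 1).pow (p + 1)).const_mul (c / (p + 1))
    refine ((hf t ht).sub this).congr_deriv ?_
    have : (p : ℝ) + 1 ≠ 0 := by positivity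
    simp only [Nat.add_sub_cancel, Nat.cast_add, Nat.cast_one, id]
    field_simp
  have hm : MonotoneOn (fun t => f t - c / (p + 1) * (t - 1) ^ (p + 1)) (Set.Icc 1 w) := by
    refine monotoneOn_of_deriv_nonneg (convex_Icc _ _) ?_ ?_ ?_
    · exact fun t ht => (hd t (by linarith [ht.1])).continuousAt.continuousWithinAt
    · rw [interior_Icc]
      exact fun t ht => (hd t (by linarith [ht.1])).differentiableAt.differentiableWithinAt
    · rw [interior_Icc]
      intro t ht
      rw [(hd t (by linarith [ht.1])).deriv]
      linarith [hle t ⟨ht.1.le, ht.2.le⟩]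
  intro t ht
  have := hm (Set.left_mem_Icc.mpr (ht.1.trans ht.2)) ht ht.1
  simp only [hf1, sub_self] at this
  rw [zero_pow (Nat.succ_ne_zero p)] at this
  linarith

theorem padeError_bounds_of_top {ν w c d : ℝ} {r : ℕ}
    (hc : ∀ t ∈ Set.Icc 1 w, c * (t - 1) ^ r ≤ padeError ν r (r + 1) t)
    (hd : ∀ t ∈ Set.Icc 1 w, padeError ν r (r + 1) t ≤ d * (t - 1) ^ r) (m : ℕ) (hm : m ≤ r + 1) :
    ∀ t ∈ Set.Icc 1 w,
      c * (r.factorial / (r + m).factorial) * (t - 1) ^ (r + m) ≤ padeError ν r (r + 1 - m) t ∧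
      padeError ν r (r + 1 - m) t ≤ d * (r.factorial / (r + m).factorial) * (t - 1) ^ (r + m) := by
  induction m with
  | zero =>
    intro t ht
    have : (r.factorial : ℝ) ≠ 0 := by positivity
    simpa [div_self this] using ⟨hc t ht, hd t ht⟩
  | succ m ih =>
    have ih := ih (by omega)
    have hs : r + 1 - m = (r + 1 - (m + 1)) + 1 := by omega
    rw [hs] at ih
    have h0 : padeError ν r (r + 1 - (m + 1)) 1 = 0 := padeError_one ν (by omega)
    have hfac : ∀ e : ℝ, e * (r.factorial / (r + m).factorial) / ((r + m : ℕ) + 1) =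
        e * (r.factorial / (r + (m + 1)).factorial) := by
      intro e
      rw [← add_assoc, Nat.factorial_succ]
      push_cast
      field_simp
    intro t ht
    constructor
    · have := le_of_le_hasDerivAt h0 (fun t ht => hasDerivAt_padeError ν r _ ht)
        (fun t ht => (ih t ht).1) t ht
      rwa [hfac] at this
    · have := le_of_le_hasDerivAt (f := fun t => - padeError ν r (r + 1 - (m + 1)) t)
        (c := - (d * (r.factorial / (r + m).factorial))) (by rw [h0, neg_zero])
        (fun t ht => (hasDerivAt_padeError ν r _ ht).neg)
        (fun t ht => (neg_mul _ _).trans_le (neg_le_neg (ih t ht).2)) t ht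
      rw [neg_div, hfac, neg_mul, neg_le_neg_iff] at this
      exact this

open Finset in
theorem half_le_prod_one_sub (ν : ℝ) (h0 : 0 ≤ ν) (h1 : ν ≤ 1 / 3) (r : ℕ) :
    1 / 2 + 1 / (2 * ((r : ℝ) + 1)) ≤ ∏ j ∈ range r, (1 - ν ^ 2 / ((j : ℝ) + 1) ^ 2) := by
  induction r with
  | zero => norm_num
  | succ r ih =>
    rw [prod_range_succ]
    have hr : (0 : ℝ) ≤ r := r.cast_nonneg
    have h2 : ν ^ 2 / ((r : ℝ) + 1) ^ 2 ≤ 1 / (9 * ((r : ℝ) + 1) ^ 2) := by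
      rw [div_le_div_iff₀ (by positivity) (by positivity)]
      have : ν ^ 2 ≤ 1 / 9 := by nlinarith only [h0, h1]
      nlinarith only [this, sq_nonneg ((r : ℝ) + 1)]
    have h3 : 1 / (9 * ((r : ℝ) + 1) ^ 2) ≤ 1 := by
      rw [div_le_one (by positivity)]; nlinarith only [hr]
    calc _ ≤ (1 / 2 + 1 / (2 * ((r : ℝ) + 1))) * (1 - 1 / (9 * ((r : ℝ) + 1) ^ 2)) := by
          push_cast
          rw [← sub_nonneg]
          have : (1 / 2 + 1 / (2 * ((r : ℝ) + 1))) * (1 - 1 / (9 * ((r : ℝ) + 1) ^ 2)) -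
              (1 / 2 + 1 / (2 * ((r : ℝ) + 1 + 1))) =
              (9 * ((r : ℝ) + 1) ^ 2 - (r + 2) ^ 2) / (18 * (r + 1) ^ 3 * (r + 2)) := by
            field_simp; ring
          rw [this]
          apply div_nonneg _ (by positivity)
          nlinarith only [hr]
      _ ≤ _ := by
          apply mul_le_mul ih (by linarith only [h2]) (by linarith only [h3])
          exact le_trans (by positivity) ih

open Finset in
theorem prod_add_mul_prod_sub (ν : ℝ) (r : ℕ) :
    (∏ j ∈ range (r + 1), (ν + j)) * (∏ j ∈ range r, ((j : ℝ) + 1 - ν)) =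
      ν * (r.factorial : ℝ) ^ 2 * ∏ j ∈ range r, (1 - ν ^ 2 / ((j : ℝ) + 1) ^ 2) := by
  induction r with
  | zero => simp
  | succ r ih =>
    rw [prod_range_succ _ (r + 1), prod_range_succ (fun j : ℕ => (j : ℝ) + 1 - ν) r,
      prod_range_succ (fun j : ℕ => 1 - ν ^ 2 / ((j : ℝ) + 1) ^ 2) r, Nat.factorial_succ]
    have h : (∏ j ∈ range (r + 1), (ν + j)) * (ν + (r + 1 : ℕ)) *
        ((∏ j ∈ range r, ((j : ℝ) + 1 - ν)) * (r + 1 - ν)) =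
        ((∏ j ∈ range (r + 1), (ν + j)) * (∏ j ∈ range r, ((j : ℝ) + 1 - ν))) *
          ((ν + (r + 1)) * (r + 1 - ν)) := by push_cast; ring
    rw [h, ih]
    have : ((r : ℝ) + 1) ≠ 0 := by positivity
    push_cast
    field_simp
    ring

/-- Two-sided bound for the error of the Padé approximation of `t ^ ν` at `t = 1`. -/
theorem padeError_zero_bounds {ν w : ℝ} (h0 : 0 < ν) (h1 : ν ≤ 1 / 3) (hw : 1 ≤ w) (r : ℕ) :
    ν * (w - 1) ^ (2 * r + 1) ≤
        2 * ((2 * r + 1) * r.centralBinom) * w ^ (r + 1) * padeError ν r 0 w ∧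
      (2 * r + 1) * r.centralBinom * padeError ν r 0 w ≤ ν * (w - 1) ^ (2 * r + 1) := by
  set κ := ∏ j ∈ Finset.range r, (1 - ν ^ 2 / ((j : ℝ) + 1) ^ 2) with hκ
  have hκ1 : 1 / 2 ≤ κ := le_trans (by
    have : (0 : ℝ) ≤ 1 / (2 * ((r : ℝ) + 1)) := by positivity
    linarith) (half_le_prod_one_sub ν h0.le h1 r)
  have hκ2 : κ ≤ 1 := by
    refine Finset.prod_le_one (fun j _ => ?_) (fun j _ => ?_)
    · have : ν ^ 2 / ((j : ℝ) + 1) ^ 2 ≤ 1 := by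
        rw [div_le_one (by positivity)]
        have : (0 : ℝ) ≤ j := j.cast_nonneg
        nlinarith
      linarith
    · have : 0 ≤ ν ^ 2 / ((j : ℝ) + 1) ^ 2 := by positivity
      linarith
  have hr : (r.factorial : ℝ) ≠ 0 := by positivity
  have htop : ∀ t : ℝ, 0 < t → padeError ν r (r + 1) t =
      ν * r.factorial * κ * ((t - 1) ^ r * t ^ (ν - r - 1)) := by
    intro t ht
    rw [padeError_succ_self ν r ht, prod_add_mul_prod_sub, ← hκ]
    field_simp
  have hb := padeError_bounds_of_top (ν := ν) (w := w) (r := r)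
    (c := ν * r.factorial * κ * (w ^ (r + 1))⁻¹) (d := ν * r.factorial * κ) ?_ ?_ (r + 1) le_rfl w
    ⟨hw, le_rfl⟩
  · have hfac : (r.factorial : ℝ) / (r + (r + 1)).factorial =
        1 / (r.factorial * ((2 * r + 1) * r.centralBinom)) := by
      have h := Nat.choose_mul_factorial_mul_factorial (show r ≤ 2 * r by omega)
      rw [show 2 * r - r = r by omega, ← Nat.centralBinom] at h
      rw [show r + (r + 1) = 2 * r + 1 by ring, Nat.factorial_succ, ← h]
      have := Nat.centralBinom_pos r
      push_cast
      field_simp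
    rw [hfac, Nat.sub_self, show r + (r + 1) = 2 * r + 1 by ring] at hb
    have hE : (0 : ℝ) < (2 * r + 1) * r.centralBinom := by
      have := Nat.centralBinom_pos r
      positivity
    set E : ℝ := (2 * r + 1) * r.centralBinom
    have hp : (0 : ℝ) ≤ ν * (w - 1) ^ (2 * r + 1) :=
      mul_nonneg h0.le (pow_nonneg (by linarith) _)
    have hwp : (0 : ℝ) < w ^ (r + 1) := by positivity
    constructor
    · have h := hb.1
      have e1 : ν * r.factorial * κ * (w ^ (r + 1))⁻¹ * (1 / (r.factorial * E)) *
          (w - 1) ^ (2 * r + 1) = κ * (ν * (w - 1) ^ (2 * r + 1)) / (w ^ (r + 1) * E) := by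
        field_simp
      rw [e1, div_le_iff₀ (by positivity)] at h
      nlinarith
    · have h := hb.2
      have e1 : ν * r.factorial * κ * (1 / (r.factorial * E)) *
          (w - 1) ^ (2 * r + 1) = κ * (ν * (w - 1) ^ (2 * r + 1)) / E := by
        field_simp
      rw [e1, le_div_iff₀ (by positivity)] at h
      nlinarith
  · intro t ht
    have ht0 : 0 < t := by linarith [ht.1]
    rw [htop t ht0]
    have : (w ^ (r + 1))⁻¹ ≤ t ^ (ν - r - 1) := by
      calc (w ^ (r + 1))⁻¹ ≤ (t ^ (r + 1))⁻¹ := by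
            gcongr; exact ht.2
        _ = t ^ (-((r + 1 : ℕ) : ℝ)) := by rw [Real.rpow_neg ht0.le, Real.rpow_natCast]
        _ ≤ _ := Real.rpow_le_rpow_of_exponent_le ht.1 (by push_cast; linarith)
    have hnn : 0 ≤ ν * r.factorial * κ * (t - 1) ^ r :=
      mul_nonneg (by positivity) (pow_nonneg (by linarith [ht.1]) _)
    nlinarith [mul_le_mul_of_nonneg_left this hnn]
  · intro t ht
    have ht0 : 0 < t := by linarith [ht.1]
    rw [htop t ht0]
    have : t ^ (ν - r - 1) ≤ 1 := by
      apply Real.rpow_le_one_of_one_le_of_nonpos ht.1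
      have : (0 : ℝ) ≤ r := r.cast_nonneg
      linarith
    have hnn : 0 ≤ ν * r.factorial * κ * (t - 1) ^ r :=
      mul_nonneg (by positivity) (pow_nonneg (by linarith [ht.1]) _)
    nlinarith [mul_le_mul_of_nonneg_left this hnn]

theorem two_mul_add_one_mul_centralBinom_sq_le (r : ℕ) :
    (2 * r + 1) * r.centralBinom ^ 2 ≤ 16 ^ r := by
  induction r with
  | zero => simp
  | succ r ih =>
    have h := Nat.succ_mul_centralBinom_succ r
    have h2 : (r + 1) ^ 2 * ((2 * (r + 1) + 1) * (r + 1).centralBinom ^ 2) =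
        (2 * r + 3) * (2 * (2 * r + 1) * r.centralBinom) ^ 2 := by
      rw [← h]; ring
    refine le_of_mul_le_mul_left (a := (r + 1) ^ 2) ?_ (by exact pow_pos r.succ_pos 2)
    rw [h2]
    calc (2 * r + 3) * (2 * (2 * r + 1) * r.centralBinom) ^ 2
        = (2 * r + 3) * (4 * (2 * r + 1)) * ((2 * r + 1) * r.centralBinom ^ 2) := by ring
      _ ≤ (16 * (r + 1) ^ 2) * 16 ^ r := Nat.mul_le_mul (by nlinarith) ih
      _ = _ := by ring

/-- Padé approximants of the binomial function provide integers `p`, `q` such that `p / q` is a good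
approximation of `(L / M) ^ (1 / k)`. -/
theorem exists_pade_approximation {k : ℕ} (hk : 3 ≤ k) (r : ℕ) {M L : ℝ} (hM : 0 < M) (hL : M ≤ L)
    (hMz : ∃ z : ℤ, (z : ℝ) = M) (hLz : ∃ z : ℤ, (z : ℝ) = L) :
    ∃ p q : ℤ, 0 ≤ (q : ℝ) ∧ (q : ℝ) ≤ k ^ (2 * r) * r.centralBinom * L ^ r ∧
      k * ((2 * r + 1) * r.centralBinom) * M ^ (r + 1) * ((L / M) ^ (1 / k : ℝ) * q - p) ≤
        k ^ (2 * r) * (L - M) ^ (2 * r + 1) ∧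
      (k : ℝ) ^ (2 * r) * (L - M) ^ (2 * r + 1) ≤
        2 * k * ((2 * r + 1) * r.centralBinom) * L ^ (r + 1) *
          ((L / M) ^ (1 / k : ℝ) * q - p) := by
  have hk0 : 0 < k := by omega
  have hk' : (3 : ℝ) ≤ k := by exact_mod_cast hk
  have hν0 : (0 : ℝ) < 1 / k := by positivity
  have hν1 : (1 / k : ℝ) ≤ 1 / 3 := by
    rw [div_le_div_iff₀ (by positivity) (by norm_num)]; linarith
  have hL0 : 0 < L := by linarith
  obtain ⟨zM, hzM⟩ := hMz
  obtain ⟨zL, hzL⟩ := hLz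
  have hint : ∀ ν : ℝ, (ν = 1 / k ∨ ν = -(1 / k)) → ∃ z : ℤ,
      (z : ℝ) = k ^ (2 * r) * ∑ i ∈ Finset.range (r + 1),
        padeCoeff ν r i * (L ^ i * M ^ (r - i)) := by
    intro ν hν
    have : ∀ i : ℕ, ∃ z : ℤ, i ≤ r → (z : ℝ) = k ^ (2 * r) * padeCoeff ν r i := by
      intro i
      by_cases hi : i ≤ r
      · obtain ⟨z, hz⟩ := exists_int_padeCoeff_eq hk0 hi hν
        exact ⟨z, fun _ => hz⟩
      · exact ⟨0, fun h => absurd h hi⟩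
    choose c hc using this
    refine ⟨∑ i ∈ Finset.range (r + 1), c i * (zL ^ i * zM ^ (r - i)), ?_⟩
    push_cast
    rw [Finset.mul_sum, hzM, hzL]
    refine Finset.sum_congr rfl fun i hi => ?_
    rw [hc i (Nat.lt_succ_iff.mp (Finset.mem_range.mp hi))]
    ring
  obtain ⟨p, hp⟩ := hint _ (Or.inl rfl)
  obtain ⟨q, hq⟩ := hint _ (Or.inr rfl)
  set ν : ℝ := 1 / k with hν
  have hw0 : 0 < L / M := by positivity
  have hδ : (L / M) ^ ν * q - p = k ^ (2 * r) * M ^ r * padeError ν r 0 (L / M) := by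
    rw [hp, hq, padeError, mul_left_comm, ← mul_sub, mul_assoc, Finset.mul_sum, Finset.mul_sum,
      ← Finset.sum_sub_distrib]
    congr 1
    refine Finset.sum_congr rfl fun i hi => ?_
    have hi' := Nat.lt_succ_iff.mp (Finset.mem_range.mp hi)
    have e : L ^ i * M ^ (r - i) = M ^ r * (L / M) ^ i := by
      rw [div_pow, ← Nat.sub_add_cancel hi', pow_add, Nat.add_sub_cancel]
      field_simp
    simp only [Finset.range_zero, Finset.prod_empty, Nat.cast_zero, sub_zero, mul_one]
    rw [Real.rpow_add hw0, Real.rpow_natCast, e]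
    ring
  obtain ⟨hlow, hup⟩ := padeError_zero_bounds hν0 hν1 (show 1 ≤ L / M by
    rwa [le_div_iff₀ hM, one_mul]) r
  have hw1 : L / M - 1 = (L - M) / M := by field_simp
  rw [hw1, hν] at hlow hup
  rw [← hν] at hlow hup
  have hE : (0 : ℝ) < (2 * r + 1) * r.centralBinom := by
    have := Nat.centralBinom_pos r
    positivity
  set e := padeError ν r 0 (L / M)
  set E : ℝ := (2 * r + 1) * r.centralBinom
  have hkν : (k : ℝ) * ν = 1 := by rw [hν]; field_simp
  refine ⟨p, q, ?_, ?_, ?_, ?_⟩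
  · rw [hq]
    refine mul_nonneg (by positivity) (Finset.sum_nonneg fun i hi => ?_)
    exact mul_nonneg (padeCoeff_nonneg (by linarith) (by linarith)
      (Nat.lt_succ_iff.mp (Finset.mem_range.mp hi))) (by positivity)
  · rw [hq, mul_assoc]
    refine mul_le_mul_of_nonneg_left ?_ (by positivity)
    rw [← sum_padeCoeff (-ν) r, Finset.sum_mul]
    refine Finset.sum_le_sum fun i hi => ?_
    have hi' := Nat.lt_succ_iff.mp (Finset.mem_range.mp hi)
    refine mul_le_mul_of_nonneg_left ?_ (padeCoeff_nonneg (by linarith) (by linarith) hi')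
    calc L ^ i * M ^ (r - i) ≤ L ^ i * L ^ (r - i) := by gcongr
      _ = L ^ r := by rw [← pow_add, Nat.add_sub_cancel' hi']
  · rw [hδ]
    have h := mul_le_mul_of_nonneg_left hup
      (show 0 ≤ (k : ℝ) ^ (2 * r) * k * M ^ (2 * r + 1) by positivity)
    have e1 : (k : ℝ) ^ (2 * r) * k * M ^ (2 * r + 1) * (ν * ((L - M) / M) ^ (2 * r + 1)) =
        k ^ (2 * r) * (k * ν) * (L - M) ^ (2 * r + 1) := by
      rw [div_pow]; field_simp
    rw [e1, hkν, mul_one] at h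
    calc _ = (k : ℝ) ^ (2 * r) * k * M ^ (2 * r + 1) * (E * e) := by ring
      _ ≤ _ := h
  · rw [hδ]
    have h := mul_le_mul_of_nonneg_left hlow
      (show 0 ≤ (k : ℝ) ^ (2 * r) * k * M ^ (2 * r + 1) by positivity)
    have e1 : (k : ℝ) ^ (2 * r) * k * M ^ (2 * r + 1) * (ν * ((L - M) / M) ^ (2 * r + 1)) =
        k ^ (2 * r) * (k * ν) * (L - M) ^ (2 * r + 1) := by
      rw [div_pow]; field_simp
    rw [e1, hkν, mul_one] at h
    refine h.trans (le_of_eq ?_)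
    rw [div_pow, show M ^ (2 * r + 1) = M ^ r * M ^ (r + 1) by rw [← pow_add]; congr 1; ring]
    field_simp

set_option maxHeartbeats 1000000 in
/-- Two solutions of `α x ^ k = β y ^ k + D` of suitable relative size give a contradiction, by
comparing the Padé approximants from the smaller one with the larger one. -/
theorem false_of_pade_approximation {k : ℕ} (hk : 3 ≤ k) (r : ℕ) {α β x y x' y' D : ℕ}
    (hα : 0 < α) (hβ : 0 < β) (hx : 0 < x) (hy : 0 < y) (hx' : 0 < x') (hy' : 0 < y') (hD : 0 < D)
    (h : α * x ^ k = β * y ^ k + D) (h' : α * x' ^ k = β * y' ^ k + D)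
    (hsmall : (α * x' ^ k) * k ^ (2 * r * k) * D ^ ((2 * r + 1) * k) <
      α * β * k ^ k * 4 ^ (r * k) * (β * y ^ k) ^ ((r + 1) * k - 1))
    (hnonvan : 2 * 16 ^ r * (α * x ^ k) ^ (2 * r + 2) <
      (β * y ^ k) * (β * y' ^ k) * D ^ (2 * r)) : False := by
  have hk0 : 0 < k := by omega
  have hM : 0 < β * y ^ k := by positivity
  obtain ⟨p, q, hq0, hq, hδ1, hδ2⟩ := exists_pade_approximation hk r
    (M := β * (y : ℝ) ^ k) (L := α * (x : ℝ) ^ k) (by positivity)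
    (by
      have : (α * x ^ k : ℝ) = β * y ^ k + D := by exact_mod_cast h
      rw [this]; linarith [D.cast_nonneg (α := ℝ)])
    ⟨(β * y ^ k : ℕ), by push_cast; rfl⟩ ⟨(α * x ^ k : ℕ), by push_cast; rfl⟩
  have hE4 : (4 : ℝ) ^ r ≤ (2 * r + 1) * r.centralBinom := by
    exact_mod_cast Nat.four_pow_le_two_mul_add_one_mul_central_binom r
  have hE16 : (2 * r + 1) * (r.centralBinom : ℝ) ^ 2 ≤ 16 ^ r := by
    exact_mod_cast two_mul_add_one_mul_centralBinom_sq_le r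
  have hCpos : (0 : ℝ) < r.centralBinom := by exact_mod_cast Nat.centralBinom_pos r
  have hEpos : (0 : ℝ) < (2 * r + 1) * r.centralBinom := by positivity
  have hR : (α * x ^ k : ℝ) = β * y ^ k + D := by exact_mod_cast h
  have hR' : (α * x' ^ k : ℝ) = β * y' ^ k + D := by exact_mod_cast h'
  have hLMD : (α * x ^ k : ℝ) - β * y ^ k = D := by rw [hR]; ring
  rw [hLMD] at hδ1 hδ2
  have hαR : (0 : ℝ) < α := by exact_mod_cast hα
  have hβR : (0 : ℝ) < β := by exact_mod_cast hβ
  have hxR : (0 : ℝ) < x := by exact_mod_cast hx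
  have hyR : (0 : ℝ) < y := by exact_mod_cast hy
  have hxR' : (0 : ℝ) < x' := by exact_mod_cast hx'
  have hyR' : (0 : ℝ) < y' := by exact_mod_cast hy'
  have hDR : (0 : ℝ) < D := by exact_mod_cast hD
  have hkR : (0 : ℝ) < k := by exact_mod_cast hk0
  have hsm : ((α * x' ^ k) * k ^ (2 * r * k) * D ^ ((2 * r + 1) * k) : ℝ) <
      α * β * k ^ k * 4 ^ (r * k) * (β * y ^ k) ^ ((r + 1) * k - 1) := by exact_mod_cast hsmall
  have hnv : (2 * 16 ^ r * (α * x ^ k) ^ (2 * r + 2) : ℝ) <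
      (β * y ^ k) * (β * y' ^ k) * D ^ (2 * r) := by exact_mod_cast hnonvan
  set M : ℝ := β * (y : ℝ) ^ k with hMdef
  set L : ℝ := α * (x : ℝ) ^ k with hLdef
  set M' : ℝ := β * (y' : ℝ) ^ k with hMdef'
  set E : ℝ := (2 * r + 1) * r.centralBinom with hE
  set ω : ℝ := (L / M) ^ (1 / k : ℝ) with hω
  set ω' : ℝ := ((M' + D) / M') ^ (1 / k : ℝ) with hω'
  set δ : ℝ := ω * q - p with hδ
  have hMp : 0 < M := by positivity
  have hLp : 0 < L := by positivity
  have hMp' : 0 < M' := by positivity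
  have hωk : ω ^ k = L / M := by
    rw [hω, ← Real.rpow_natCast, ← Real.rpow_mul (by positivity), one_div_mul_cancel hkR.ne',
      Real.rpow_one]
  have hωk' : ω' ^ k = (M' + D) / M' := by
    rw [hω', ← Real.rpow_natCast, ← Real.rpow_mul (by positivity), one_div_mul_cancel hkR.ne',
      Real.rpow_one]
  have hω1 : 1 ≤ ω := Real.one_le_rpow
    (by rw [le_div_iff₀ hMp, hR]; linarith) (by positivity)
  have hω1' : 1 ≤ ω' := Real.one_le_rpow
    (by rw [le_div_iff₀ hMp']; linarith) (by positivity)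
  have hωL : ω * M ≤ L := by
    rw [← le_div_iff₀ hMp, ← hωk]
    exact le_self_pow₀ hω1 hk0.ne'
  have hber : k * (ω' - 1) * M' ≤ D := by
    have h1 := one_add_mul_le_pow (a := ω' - 1) (by linarith) k
    rw [add_sub_cancel, hωk', le_div_iff₀ hMp'] at h1
    linarith
  have hcross : ω * (y * x') = ω' * (x * y') := by
    refine (pow_left_inj₀ (by positivity) (by positivity) hk0.ne').mp ?_
    rw [mul_pow, mul_pow ω', hωk, hωk', ← hR', hLdef, hMdef, hMdef', mul_pow, mul_pow]
    field_simp
  have hLM : M * (x * y') ≤ L * (y * x') := by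
    have h1 : (x * y' : ℝ) ≤ ω * (y * x') := by
      rw [hcross]; exact le_mul_of_one_le_left (by positivity) hω1'
    calc M * (x * y') ≤ M * (ω * (y * x')) := by gcongr
      _ = (ω * M) * (y * x') := by ring
      _ ≤ _ := by gcongr
  have hδpos : 0 < δ := by
    have h1 : 0 < (k : ℝ) ^ (2 * r) * D ^ (2 * r + 1) := by positivity
    have h2 : 0 < 2 * k * E * L ^ (r + 1) := by positivity
    exact (pos_iff_pos_of_mul_pos (h1.trans_le hδ2)).mp h2
  have hΔ : ((y * x' * p - x * y' * q : ℤ) : ℝ) = q * (x * y') * (ω' - 1) - y * x' * δ := by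
    have : q * (x * y') * (ω' - 1) = q * (ω' * (x * y')) - q * (x * y') := by ring
    rw [this, ← hcross, hδ]
    push_cast
    ring
  have hlt1 : y * x' * δ < 1 := by
    have h1 : ((y * x' * k ^ (2 * r) * D ^ (2 * r + 1) : ℝ)) ^ k < (k * E * M ^ (r + 1)) ^ k := by
      have e1 : (α * β : ℝ) * (y * x' * k ^ (2 * r) * D ^ (2 * r + 1)) ^ k =
          M * ((α * x' ^ k) * k ^ (2 * r * k) * D ^ ((2 * r + 1) * k)) := by
        rw [hMdef]; ring
      have e2 : M * (α * β * k ^ k * 4 ^ (r * k) * M ^ ((r + 1) * k - 1)) =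
          α * β * (k * 4 ^ r * M ^ (r + 1)) ^ k := by
        have : (r + 1) * k = (r + 1) * k - 1 + 1 := by
          have : 0 < (r + 1) * k := by positivity
          omega
        rw [mul_pow, mul_pow, ← pow_mul, ← pow_mul M, this, Nat.add_sub_cancel, pow_succ]
        ring
      have h2 := mul_lt_mul_of_pos_left hsm hMp
      rw [← e1, e2] at h2
      refine (lt_of_mul_lt_mul_left h2 (by positivity)).trans_le ?_
      gcongr
    have h2 := lt_of_pow_lt_pow_left₀ k (by positivity) h1
    have h3 : 0 < k * E * M ^ (r + 1) := by positivity
    by_contra hcon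
    push Not at hcon
    have h4 : k * E * M ^ (r + 1) ≤ k * E * M ^ (r + 1) * (y * x' * δ) :=
      le_mul_of_one_le_right h3.le hcon
    have h5 : (y * x') * (k * E * M ^ (r + 1) * δ) ≤ (y * x') * (k ^ (2 * r) * D ^ (2 * r + 1)) :=
      mul_le_mul_of_nonneg_left hδ1 (by positivity)
    refine absurd h2 (not_lt.mpr ?_)
    calc k * E * M ^ (r + 1) ≤ k * E * M ^ (r + 1) * (y * x' * δ) := h4
      _ = (y * x') * (k * E * M ^ (r + 1) * δ) := by ring
      _ ≤ (y * x') * (k ^ (2 * r) * D ^ (2 * r + 1)) := h5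
      _ = _ := by ring
  have hlt2 : q * (x * y') * (ω' - 1) < y * x' * δ := by
    have hc : 0 < M' * (2 * k * E * L ^ (r + 2)) := by positivity
    refine lt_of_mul_lt_mul_left ?_ hc.le
    calc M' * (2 * k * E * L ^ (r + 2)) * (q * (x * y') * (ω' - 1))
        = (2 * E * L ^ (r + 2)) * (x * y') * (q * (k * (ω' - 1) * M')) := by ring
      _ ≤ (2 * E * L ^ (r + 2)) * (x * y') * ((k ^ (2 * r) * r.centralBinom * L ^ r) * D) := by
          have : 0 ≤ k * (ω' - 1) * M' :=
            mul_nonneg (mul_nonneg hkR.le (by linarith)) hMp'.le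
          gcongr
      _ = (2 * ((2 * r + 1) * r.centralBinom ^ 2) * L ^ (2 * r + 2)) *
            ((x * y') * k ^ (2 * r) * D) := by rw [hE]; ring
      _ ≤ (2 * 16 ^ r * L ^ (2 * r + 2)) * ((x * y') * k ^ (2 * r) * D) := by gcongr
      _ < (M * M' * D ^ (2 * r)) * ((x * y') * k ^ (2 * r) * D) := by gcongr
      _ = (M * (x * y')) * (M' * (k ^ (2 * r) * D ^ (2 * r + 1))) := by ring
      _ ≤ (L * (y * x')) * (M' * (2 * k * E * L ^ (r + 1) * δ)) := by gcongr
      _ = _ := by ring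
  have hqnn : 0 ≤ q * (x * y') * (ω' - 1) :=
    mul_nonneg (mul_nonneg hq0 (by positivity)) (by linarith)
  have hz1 : ((-1 : ℤ) : ℝ) < ((y * x' * p - x * y' * q : ℤ) : ℝ) := by
    rw [hΔ]; push_cast; linarith
  have hz2 : ((y * x' * p - x * y' * q : ℤ) : ℝ) < ((0 : ℤ) : ℝ) := by
    rw [hΔ]; push_cast; linarith
  have hz3 := Int.cast_lt.mp hz1
  have hz4 := Int.cast_lt.mp hz2
  omega

/-- The gap principle for solutions of `α x ^ k = β y ^ k + D`. -/
theorem gap_of_solutions {k α β x y x' y' D : ℕ} (hk : 3 ≤ k)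
    (hα : 0 < α) (hx' : 0 < x')
    (h : α * x ^ k = β * y ^ k + D) (h' : α * x' ^ k = β * y' ^ k + D) (hD : 0 < D)
    (hlt : β * y ^ k < β * y' ^ k) :
    k ^ k * (α * β) * (β * y ^ k) ^ (k - 1) ≤ D ^ k * (α * x' ^ k) := by
  obtain ⟨j, hj⟩ : ∃ j, k - 1 = j := ⟨_, rfl⟩
  have hkj : ∀ z : ℕ, z ^ k = z ^ j * z := fun z => by rw [← pow_succ]; congr 1; omega
  have e1 : α * β * (x' * y) ^ k = (α * x' ^ k) * (β * y ^ k) := by ring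
  have e2 : α * β * (x * y') ^ k = (α * x ^ k) * (β * y' ^ k) := by ring
  have hlt2 : x' * y < x * y' := by
    refine lt_of_pow_lt_pow_left₀ k (Nat.zero_le _)
      (lt_of_mul_lt_mul_left (a := α * β) ?_ (Nat.zero_le _))
    rw [e1, e2, h, h']
    nlinarith [mul_lt_mul_of_pos_left hlt hD]
  have hpow : (x' * y) ^ k + k * (x' * y) ^ j ≤ (x * y') ^ k := by
    calc (x' * y) ^ k + k * (x' * y) ^ j ≤ (x' * y + 1) ^ k := by
          have h1 := pow_add_mul_le_add_pow (a := x' * y) (b := 1) (Nat.zero_le _) (by simp) k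
          simpa [hj] using h1
      _ ≤ _ := Nat.pow_le_pow_left hlt2 _
  have h1 : k * (α * β) * (x' * y) ^ j ≤ D * (α * x' ^ k) := by
    have h2 := Nat.mul_le_mul_left (α * β) hpow
    rw [mul_add, e1, e2, h, h'] at h2
    rw [h']
    nlinarith [Nat.zero_le (D * D), Nat.zero_le (D * (β * y ^ k))]
  have h2 := Nat.pow_le_pow_left h1 k
  rw [hj]
  refine le_of_mul_le_mul_right (a := (α * x' ^ k) ^ j) ?_ (by positivity)
  calc k ^ k * (α * β) * (β * y ^ k) ^ j * (α * x' ^ k) ^ j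
      = k ^ k * (α * β) * (α * β * (x' * y) ^ k) ^ j := by rw [e1]; ring
    _ = k ^ k * ((α * β) ^ j * (α * β)) * ((x' * y) ^ k) ^ j := by ring
    _ = (k * (α * β) * (x' * y) ^ j) ^ k := by rw [← hkj (α * β)]; ring
    _ ≤ _ := h2
    _ = D ^ k * (α * x' ^ k) * (α * x' ^ k) ^ j := by rw [mul_pow, hkj (α * x' ^ k)]; ring

theorem false_of_large_solutions {k α β x y x' y' D : ℕ} (hk : 3 ≤ k) (R : ℕ)
    (hα : 0 < α) (hβ : 0 < β) (hx : 0 < x) (hy : 0 < y) (hx' : 0 < x') (hy' : 0 < y') (hD : 0 < D)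
    (h : α * x ^ k = β * y ^ k + D) (h' : α * x' ^ k = β * y' ^ k + D)
    (hDM : D ≤ β * y' ^ k)
    (hS : k ^ (2 * k) * D ^ (2 * (k - 1)) ≤ (β * y ^ k) ^ (k - 2))
    (hB : 4 * 16 ^ (R + 1) * k ^ (2 * R * k) * D ^ ((2 * R + 1) * k) * (α * x ^ k) ^ (2 * R + 4) <
      α * β * k ^ k * 4 ^ (R * k) * (β * y ^ k) ^ ((R + 1) * k) * D ^ (2 * R + 2))
    (hG : 2 * 16 ^ R * (α * x ^ k) ^ (2 * R + 2) < (β * y ^ k) * (β * y' ^ k) * D ^ (2 * R)) :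
    False := by
  have hk0 : 0 < k := by omega
  have hcon : ∀ r, (α * x' ^ k) * k ^ (2 * r * k) * D ^ ((2 * r + 1) * k) <
      α * β * k ^ k * 4 ^ (r * k) * (β * y ^ k) ^ ((r + 1) * k - 1) →
      ¬ 2 * 16 ^ r * (α * x ^ k) ^ (2 * r + 2) < (β * y ^ k) * (β * y' ^ k) * D ^ (2 * r) :=
    fun r h1 h2 => false_of_pade_approximation hk r hα hβ hx hy hx' hy' hD h h' h1 h2
  have hMp : 0 < β * y ^ k := by positivity
  have hPp : 0 < α * β := by positivity
  have hLp' : 0 < α * x' ^ k := by positivity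
  have hL2' : α * x' ^ k ≤ 2 * (β * y' ^ k) := by omega
  generalize α * x' ^ k = L' at *
  generalize β * y' ^ k = M' at *
  generalize α * x ^ k = L at *
  generalize β * y ^ k = M at *
  generalize α * β = P at *
  have hMk : k ^ 2 * D ^ 2 ≤ M := by
    refine le_of_pow_le_pow_left₀ (show k - 2 ≠ 0 by omega) (Nat.zero_le _) (le_trans ?_ hS)
    rw [mul_pow, ← pow_mul, ← pow_mul]
    exact Nat.mul_le_mul (Nat.pow_le_pow_right hk0 (by omega)) (Nat.pow_le_pow_right hD (by omega))
  have hL2 : L ≤ 2 * M := by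
    have : D ≤ k ^ 2 * D ^ 2 := by
      calc D = 1 * D ^ 1 := by ring
        _ ≤ _ := Nat.mul_le_mul (Nat.one_le_pow _ _ hk0) (Nat.pow_le_pow_right hD (by omega))
    omega
  have hDL : D ≤ L := by omega
  have hex : ∃ r, L' * k ^ (2 * r * k) * D ^ ((2 * r + 1) * k) <
      P * k ^ k * 4 ^ (r * k) * M ^ ((r + 1) * k - 1) := by
    refine ⟨L' * D ^ k, ?_⟩
    set r := L' * D ^ k with hr
    calc L' * k ^ (2 * r * k) * D ^ ((2 * r + 1) * k) = r * (k ^ 2 * D ^ 2) ^ (r * k) := by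
          rw [hr]; ring
      _ < 4 ^ (r * k) * M ^ (r * k) := by
          refine Nat.mul_lt_mul_of_lt_of_le ?_ (Nat.pow_le_pow_left hMk _) (by positivity)
          calc r < 4 ^ r := Nat.lt_pow_self (by norm_num)
            _ ≤ _ := Nat.pow_le_pow_right (by norm_num) (Nat.le_mul_of_pos_right _ hk0)
      _ ≤ 4 ^ (r * k) * M ^ ((r + 1) * k - 1) := by
          refine Nat.mul_le_mul_left _ (Nat.pow_le_pow_right hMp ?_)
          rw [add_mul]; omega
      _ ≤ P * k ^ k * 4 ^ (r * k) * M ^ ((r + 1) * k - 1) := by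
          rw [mul_assoc (P * k ^ k)]
          exact Nat.le_mul_of_pos_left _ (by positivity)
  obtain ⟨r, hr, hmin⟩ : ∃ r, (L' * k ^ (2 * r * k) * D ^ ((2 * r + 1) * k) <
      P * k ^ k * 4 ^ (r * k) * M ^ ((r + 1) * k - 1)) ∧ ∀ j < r,
      P * k ^ k * 4 ^ (j * k) * M ^ ((j + 1) * k - 1) ≤
        L' * k ^ (2 * j * k) * D ^ ((2 * j + 1) * k) := by
    classical
    exact ⟨Nat.find hex, Nat.find_spec hex, fun j hj => not_lt.mp (Nat.find_min hex hj)⟩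
  refine hcon r hr ?_
  rcases Nat.lt_or_ge R r with hRr | hRr
  · obtain ⟨j, rfl⟩ : ∃ j, r = j + 1 := ⟨r - 1, by omega⟩
    have hBj : ∀ j, R ≤ j → 4 * 16 ^ (j + 1) * k ^ (2 * j * k) * D ^ ((2 * j + 1) * k) *
        L ^ (2 * j + 4) < P * k ^ k * 4 ^ (j * k) * M ^ ((j + 1) * k) * D ^ (2 * j + 2) := by
      intro j hj
      induction j, hj using Nat.le_induction with
      | base => exact hB
      | succ j hj ih =>
        have hstep : 16 * k ^ (2 * k) * D ^ (2 * k) * L ^ 2 ≤ 4 ^ k * M ^ k * D ^ 2 := by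
          calc 16 * k ^ (2 * k) * D ^ (2 * k) * L ^ 2
              ≤ 16 * k ^ (2 * k) * D ^ (2 * k) * (2 * M) ^ 2 := by gcongr
            _ = 4 ^ 3 * (k ^ (2 * k) * D ^ (2 * (k - 1))) * M ^ 2 * D ^ 2 := by
                rw [show D ^ (2 * k) = D ^ (2 * (k - 1)) * D ^ 2 by
                  rw [← pow_add]; congr 1; omega]
                ring
            _ ≤ 4 ^ k * M ^ (k - 2) * M ^ 2 * D ^ 2 := by gcongr; norm_num
            _ = _ := by
                rw [mul_assoc (4 ^ k), ← pow_add, Nat.sub_add_cancel (by omega)]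
        calc _ = (4 * 16 ^ (j + 1) * k ^ (2 * j * k) * D ^ ((2 * j + 1) * k) * L ^ (2 * j + 4)) *
              (16 * k ^ (2 * k) * D ^ (2 * k) * L ^ 2) := by ring
          _ < (P * k ^ k * 4 ^ (j * k) * M ^ ((j + 1) * k) * D ^ (2 * j + 2)) *
              (4 ^ k * M ^ k * D ^ 2) :=
            Nat.mul_lt_mul_of_lt_of_le ih hstep (by positivity)
          _ = _ := by ring
    have h1 := hBj j (by omega)
    have h2 := hmin j (by omega)
    have hK : 0 < 2 * (k ^ (2 * j * k) * D ^ ((2 * j + 1) * k)) := by positivity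
    refine lt_of_mul_lt_mul_right (a := 2 * (k ^ (2 * j * k) * D ^ ((2 * j + 1) * k))) ?_ hK.le
    calc _ = 4 * 16 ^ (j + 1) * k ^ (2 * j * k) * D ^ ((2 * j + 1) * k) * L ^ (2 * j + 4) := by ring
      _ < _ := h1
      _ = M * D ^ (2 * j + 2) * (P * k ^ k * 4 ^ (j * k) * M ^ ((j + 1) * k - 1)) := by
          have : (j + 1) * k = (j + 1) * k - 1 + 1 := by
            have : 0 < (j + 1) * k := by positivity
            omega
          rw [this, Nat.add_sub_cancel, pow_succ]
          ring
      _ ≤ M * D ^ (2 * j + 2) * (L' * k ^ (2 * j * k) * D ^ ((2 * j + 1) * k)) :=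
          Nat.mul_le_mul_left _ h2
      _ ≤ M * D ^ (2 * j + 2) * (2 * M' * k ^ (2 * j * k) * D ^ ((2 * j + 1) * k)) := by gcongr
      _ = _ := by ring
  · obtain ⟨d, rfl⟩ := Nat.exists_eq_add_of_le hRr
    have hLp : 0 < L := by omega
    refine lt_of_mul_lt_mul_right (a := (16 * L ^ 2) ^ d) ?_ (Nat.zero_le _)
    calc _ = 2 * 16 ^ (r + d) * L ^ (2 * (r + d) + 2) := by ring
      _ < _ := hG
      _ = M * M' * D ^ (2 * r) * (1 * D ^ 2) ^ d := by ring
      _ ≤ _ := by gcongr; norm_num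

/-- If `a * b + n` and `a' * b + n` are `k`-th powers for all `b ∈ S`, the numbers `M b` (one of
`a' * (a * b + n)` and `a * (a' * b + n)`) grow quickly along `S` and cannot get too large. -/
theorem exists_gap_sequence {k a a' : ℕ} {n : ℤ} (hk : 3 ≤ k) (hn : n ≠ 0) (ha : 0 < a)
    (haa' : a < a') (S : Set ℕ) (hSn : ∀ b ∈ S, 2 * n.natAbs ≤ b)
    (hSa : ∀ b ∈ S, ∃ x : ℕ, 0 < x ∧ (a * b : ℤ) + n = (x : ℤ) ^ k)
    (hSa' : ∀ b ∈ S, ∃ x : ℕ, 0 < x ∧ (a' * b : ℤ) + n = (x : ℤ) ^ k) :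
    ∃ (D : ℕ) (M : ℕ → ℕ), 0 < D ∧ D ≤ n.natAbs * a' ∧ (∀ b ∈ S, 0 < M b) ∧
      (∀ b ∈ S, a * a' * b ≤ 2 * M b) ∧
      (∀ b ∈ S, ∀ b' ∈ S, b < b' →
        k ^ k * (a * a') * M b ^ (k - 1) ≤ 2 * D ^ k * M b') ∧
      ∀ b ∈ S, ∀ b' ∈ S, b < b' → ∀ R : ℕ,
        k ^ (2 * k) * D ^ (2 * (k - 1)) ≤ M b ^ (k - 2) →
        2 ^ (6 * R + 10) * k ^ (2 * R * k) * D ^ ((2 * R + 1) * k) * M b ^ (2 * R + 4) <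
          a * a' * k ^ k * 4 ^ (R * k) * M b ^ ((R + 1) * k) * D ^ (2 * R + 2) →
        2 ^ (6 * R + 3) * M b ^ (2 * R + 1) < M b' * D ^ (2 * R) → False := by
  obtain ⟨N, hN⟩ : ∃ N, n.natAbs = N := ⟨_, rfl⟩
  have hNpos : 0 < N := by omega
  rw [hN] at hSn ⊢
  obtain ⟨α, β, D, c, hα, hβ, hαβ, hD, hDle, hsol⟩ : ∃ (α β D : ℕ) (c : ℤ), 0 < α ∧ 0 < β ∧
      α * β = a * a' ∧ 0 < D ∧ D ≤ N * a' ∧ ∀ b ∈ S, ∃ x y : ℕ, 0 < x ∧ 0 < y ∧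
        α * x ^ k = β * y ^ k + D ∧ a * a' * b ≤ 2 * (β * y ^ k) ∧ D ≤ β * y ^ k ∧
        ((β * y ^ k : ℕ) : ℤ) = a * a' * b + c := by
    obtain ⟨d, rfl⟩ := Nat.exists_eq_add_of_lt haa'
    have hb2 : ∀ b ∈ S, (2 * N * (a + d + 1) : ℤ) ≤ a * (a + d + 1) * b := by
      intro b hb
      have h1 : 2 * N * (a + d + 1) ≤ a * (a + d + 1) * b := by
        calc 2 * N * (a + d + 1) ≤ b * (a + d + 1) := Nat.mul_le_mul_right _ (hSn b hb)
          _ = 1 * ((a + d + 1) * b) := by ring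
          _ ≤ a * ((a + d + 1) * b) := Nat.mul_le_mul_right _ ha
          _ = _ := by ring
      exact_mod_cast h1
    have hNa : (0 : ℤ) ≤ N * a := by positivity
    have hNd : (0 : ℤ) ≤ N * (d + 1) := by positivity
    rcases Int.natAbs_eq n with h | h
    · rw [hN] at h
      refine ⟨a + d + 1, a, N * (d + 1), N * a, by omega, ha, by ring, by positivity,
        Nat.mul_le_mul_left _ (by omega), fun b hb => ?_⟩
      obtain ⟨x, hx, hxe⟩ := hSa b hb
      obtain ⟨y, hy, hye⟩ := hSa' b hb
      have h2 := hb2 b hb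
      refine ⟨x, y, hx, hy, ?_, ?_, ?_, ?_⟩ <;> zify <;> rw [← hye] <;> try rw [← hxe]
      all_goals rw [h]; push_cast; nlinarith
    · rw [hN] at h
      refine ⟨a, a + d + 1, N * (d + 1), -(N * (a + d + 1)), ha, by omega, by ring, by positivity,
        Nat.mul_le_mul_left _ (by omega), fun b hb => ?_⟩
      obtain ⟨y, hy, hye⟩ := hSa b hb
      obtain ⟨x, hx, hxe⟩ := hSa' b hb
      have h2 := hb2 b hb
      refine ⟨x, y, hx, hy, ?_, ?_, ?_, ?_⟩ <;> zify <;> rw [← hye] <;> try rw [← hxe]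
      all_goals rw [h]; push_cast; nlinarith
  choose! x y hx hy hxy hP hDM hc using hsol
  have hlt : ∀ b ∈ S, ∀ b' ∈ S, b < b' → β * y b ^ k < β * y b' ^ k := by
    intro b hb b' hb' hbb'
    zify
    have h1 := hc b hb
    have h2 := hc b' hb'
    push_cast at h1 h2
    rw [h1, h2]
    have : (a * a' * b : ℤ) < a * a' * b' := by
      have h3 : a * a' * b < a * a' * b' := Nat.mul_lt_mul_of_pos_left hbb'
        (Nat.mul_pos ha (ha.trans haa'))
      exact_mod_cast h3
    linarith
  refine ⟨D, fun b => β * y b ^ k, hD, hDle, fun b hb => ?_, hP, fun b hb b' hb' hbb' => ?_,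
    fun b hb b' hb' hbb' R hS hB hG => ?_⟩
  · have := hy b hb
    positivity
  · rw [← hαβ]
    refine (gap_of_solutions hk hα (hx b' hb') (hxy b hb) (hxy b' hb') hD
      (hlt b hb b' hb' hbb')).trans ?_
    rw [mul_comm 2, mul_assoc]
    refine Nat.mul_le_mul_left _ ?_
    have := hDM b' hb'
    have := hxy b' hb'
    change α * x b' ^ k ≤ 2 * (β * y b' ^ k)
    omega
  · have hL : α * x b ^ k ≤ 2 * (β * y b ^ k) := by
      have := hDM b hb
      have := hxy b hb
      omega
    simp only at hS hB hG
    have hM : 0 < β * y b ^ k := by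
      have := hy b hb
      positivity
    refine false_of_large_solutions hk R hα hβ (hx b hb) (hy b hb) (hx b' hb') (hy b' hb') hD
      (hxy b hb) (hxy b' hb') (hDM b' hb') hS ?_ ?_
    · rw [hαβ]
      refine lt_of_le_of_lt ?_ hB
      calc _ ≤ 4 * 16 ^ (R + 1) * k ^ (2 * R * k) * D ^ ((2 * R + 1) * k) *
            (2 * (β * y b ^ k)) ^ (2 * R + 4) := by gcongr
        _ = 4 * 16 ^ (R + 1) * 2 ^ (2 * R + 4) * k ^ (2 * R * k) * D ^ ((2 * R + 1) * k) *
            (β * y b ^ k) ^ (2 * R + 4) := by rw [mul_pow]; ring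
        _ = _ := by
          congr 3
          rw [show 16 = 2 ^ 4 by norm_num, show 4 = 2 ^ 2 by norm_num, ← pow_mul, ← pow_add,
            ← pow_add]
          congr 1
          ring
    · calc _ ≤ 2 * 16 ^ R * (2 * (β * y b ^ k)) ^ (2 * R + 2) := by gcongr
        _ = 2 * 16 ^ R * 2 ^ (2 * R + 2) * (β * y b ^ k) ^ (2 * R + 1) * (β * y b ^ k) := by
          rw [mul_pow, show 2 * R + 2 = 2 * R + 1 + 1 by ring, pow_succ (β * y b ^ k)]; ring
        _ = (2 ^ (6 * R + 3) * (β * y b ^ k) ^ (2 * R + 1)) * (β * y b ^ k) := by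
          congr 2
          rw [show 16 = 2 ^ 4 by norm_num, ← pow_mul]
          ring
        _ < (β * y b' ^ k * D ^ (2 * R)) * (β * y b ^ k) := Nat.mul_lt_mul_of_pos_right hG hM
        _ = _ := by ring

theorem pow_le_of_growth {k P D N q B M M' : ℕ} (hk : 6 ≤ k) (hD : 0 < D) (hDN : D ≤ N * q)
    (hqP : q ≤ P) (hqB : q ≤ B) (hNB : N ^ (k ^ 2 - 2) ≤ B ^ ((k - 1) * (k - 4)))
    (hM : P * B ≤ 2 * M) (hgap : k ^ k * P * M ^ (k - 1) ≤ 2 * D ^ k * M') :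
    k ^ (2 * k) * D ^ (2 * (k - 1)) ≤ M' ^ (k - 2) := by
  have h1 : k ^ k * P ^ k * B ^ (k - 1) ≤ 2 ^ k * D ^ k * M' := by
    have e : ∀ z : ℕ, z ^ k = z * z ^ (k - 1) := fun z => by
      rw [← pow_succ']; congr 1; omega
    calc k ^ k * P ^ k * B ^ (k - 1) = k ^ k * P * (P * B) ^ (k - 1) := by
          rw [e P, mul_pow]; ring
      _ ≤ k ^ k * P * (2 * M) ^ (k - 1) := by gcongr
      _ = 2 ^ (k - 1) * (k ^ k * P * M ^ (k - 1)) := by rw [mul_pow]; ring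
      _ ≤ 2 ^ (k - 1) * (2 * D ^ k * M') := by gcongr
      _ = _ := by rw [e 2]; ring
  have h2 : D ^ (k ^ 2 - 2) ≤ P ^ (k * (k - 2)) * B ^ ((k - 1) * (k - 2)) := by
    obtain ⟨K, rfl⟩ := Nat.exists_eq_add_of_le hk
    simp only [show 6 + K - 1 = K + 5 by omega, show 6 + K - 2 = K + 4 by omega,
      show 6 + K - 4 = K + 2 by omega, show (6 + K) ^ 2 - 2 = K ^ 2 + 12 * K + 34 by
        rw [Nat.sub_eq_iff_eq_add (by nlinarith)]; ring] at *
    calc D ^ (K ^ 2 + 12 * K + 34) ≤ (N * q) ^ (K ^ 2 + 12 * K + 34) := by gcongr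
      _ = N ^ (K ^ 2 + 12 * K + 34) * (q ^ ((6 + K) * (K + 4)) * q ^ (2 * (K + 5))) := by
        rw [mul_pow, ← pow_add]; ring
      _ ≤ B ^ ((K + 5) * (K + 2)) * (P ^ ((6 + K) * (K + 4)) * B ^ (2 * (K + 5))) := by gcongr
      _ = _ := by ring
  have h3 : 2 ^ (k - 2) * k ^ 2 ≤ k ^ (k - 2) := by
    obtain ⟨K, rfl⟩ := Nat.exists_eq_add_of_le hk
    rw [show 6 + K - 2 = K + 4 by omega]
    calc 2 ^ (K + 4) * (6 + K) ^ 2 = 2 ^ K * 16 * (6 + K) ^ 2 := by ring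
      _ ≤ (6 + K) ^ K * (6 + K) ^ 2 * (6 + K) ^ 2 := by
        gcongr
        · omega
        · nlinarith
      _ = _ := by ring
  have h4 := Nat.pow_le_pow_left h1 (k - 2)
  refine le_of_mul_le_mul_left (a := (2 ^ k * D ^ k) ^ (k - 2)) ?_ (by positivity)
  calc (2 ^ k * D ^ k) ^ (k - 2) * (k ^ (2 * k) * D ^ (2 * (k - 1)))
      = (2 ^ (k - 2) * k ^ 2) ^ k * D ^ (k ^ 2 - 2) := by
        have e : k ^ 2 - 2 = k * (k - 2) + 2 * (k - 1) := by
          obtain ⟨K, rfl⟩ := Nat.exists_eq_add_of_le hk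
          rw [show 6 + K - 1 = K + 5 by omega, show 6 + K - 2 = K + 4 by omega,
            Nat.sub_eq_iff_eq_add (by nlinarith)]
          ring
        rw [e, pow_add]; ring
    _ ≤ (k ^ (k - 2)) ^ k * (P ^ (k * (k - 2)) * B ^ ((k - 1) * (k - 2))) := by gcongr
    _ = (k ^ k * P ^ k * B ^ (k - 1)) ^ (k - 2) := by ring
    _ ≤ (2 ^ k * D ^ k * M') ^ (k - 2) := h4
    _ = _ := by ring

theorem mul_lt_of_gap {k P D M M' : ℕ} (hk : 3 ≤ k) (hP : 0 < P) (hD : 0 < D) (hM : 0 < M)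
    (hS : k ^ (2 * k) * D ^ (2 * (k - 1)) ≤ M ^ (k - 2))
    (hgap : k ^ k * P * M ^ (k - 1) ≤ 2 * D ^ k * M') : 2 ^ 3 * M < M' := by
  refine lt_of_mul_lt_mul_left (a := 2 * D ^ k) ?_ (Nat.zero_le _)
  refine lt_of_lt_of_le ?_ hgap
  have h16 : 16 < k ^ k := by
    calc 16 < 3 ^ 3 := by norm_num
      _ ≤ k ^ 3 := by gcongr
      _ ≤ k ^ k := by gcongr; omega
  have hDk : D ^ k ≤ M ^ (k - 2) := by
    refine le_trans ?_ hS
    calc D ^ k ≤ 1 * D ^ (2 * (k - 1)) := by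
          rw [one_mul]; exact Nat.pow_le_pow_right hD (by omega)
      _ ≤ _ := Nat.mul_le_mul_right _ (Nat.one_le_pow _ _ (by omega))
  calc 2 * D ^ k * (2 ^ 3 * M) = 16 * D ^ k * M := by ring
    _ < k ^ k * D ^ k * M := by gcongr
    _ ≤ k ^ k * M ^ (k - 2) * M := by gcongr
    _ = k ^ k * M ^ (k - 1) := by
      rw [mul_assoc, ← pow_succ]; congr 2; omega
    _ ≤ k ^ k * P * M ^ (k - 1) := by
      gcongr; exact Nat.le_mul_of_pos_right _ hP

theorem mul_pow_lt_of_pow_le {k P D M : ℕ} (hk : 6 ≤ k) (hP : 0 < P) (hD : 0 < D) (hM : 0 < M)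
    (hS : k ^ (2 * k) * D ^ (2 * (k - 1)) ≤ M ^ (k - 2)) :
    2 ^ 10 * D ^ k * M ^ 4 < P * k ^ k * M ^ k * D ^ 2 := by
  have hMk : D ^ 2 ≤ M := by
    refine le_of_pow_le_pow_left₀ (show k - 2 ≠ 0 by omega) (Nat.zero_le _) (le_trans ?_ hS)
    rw [← pow_mul]
    calc D ^ (2 * (k - 2)) = 1 * D ^ (2 * (k - 2)) := by rw [one_mul]
      _ ≤ _ := Nat.mul_le_mul (Nat.one_le_pow _ _ (by omega))
        (Nat.pow_le_pow_right hD (by omega))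
  have hk2 : 2 ^ 10 < k ^ k := by
    calc 2 ^ 10 < 6 ^ 6 := by norm_num
      _ ≤ k ^ 6 := by gcongr
      _ ≤ k ^ k := by gcongr; omega
  have hDk : D ^ (k - 2) ≤ M ^ (k - 4) := by
    calc D ^ (k - 2) ≤ D ^ (2 * (k - 4)) := Nat.pow_le_pow_right hD (by omega)
      _ = (D ^ 2) ^ (k - 4) := by rw [pow_mul]
      _ ≤ _ := by gcongr
  calc 2 ^ 10 * D ^ k * M ^ 4 = 2 ^ 10 * (D ^ (k - 2) * M ^ 4 * D ^ 2) := by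
        rw [show D ^ k = D ^ (k - 2) * D ^ 2 by rw [← pow_add]; congr 1; omega]; ring
    _ < k ^ k * (D ^ (k - 2) * M ^ 4 * D ^ 2) := by gcongr
    _ ≤ k ^ k * (M ^ (k - 4) * M ^ 4 * D ^ 2) := by gcongr
    _ = k ^ k * M ^ k * D ^ 2 := by
        rw [← pow_add, show k - 4 + 4 = k by omega]; ring
    _ ≤ _ := by
        gcongr; exact Nat.le_mul_of_pos_left _ hP

/-- Taking logarithms in an inequality of the shape of the gap principle. -/
theorem log_gap {k P D M M' : ℕ} (hk : 0 < k) (hP : 0 < P) (hD : 0 < D) (hM : 0 < M)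
    (hM' : 0 < M') (h : k ^ k * P * M ^ (k - 1) ≤ 2 * D ^ k * M') :
    k * Real.log k + Real.log P + (k - 1 : ℕ) * Real.log M ≤
      Real.log 2 + k * Real.log D + Real.log M' := by
  have hR : ((k : ℝ) ^ k * P * M ^ (k - 1)) ≤ 2 * D ^ k * M' := by exact_mod_cast h
  have := Real.log_le_log (by positivity) hR
  rwa [Real.log_mul (by positivity) (by positivity), Real.log_mul (by positivity) (by positivity),
    Real.log_mul (by positivity) (by positivity), Real.log_mul (by positivity) (by positivity),
    Real.log_pow, Real.log_pow, Real.log_pow] at this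

theorem log_add_log_le {P Q c : ℕ} {M : ℕ} (hP : 0 < P) (hQ : 0 < Q) (hc : 0 < c)
    (h : P * Q ≤ c * M) : Real.log P + Real.log Q ≤ Real.log c + Real.log M := by
  have hM : 0 < M := by
    rcases Nat.eq_zero_or_pos M with rfl | h0
    · have := Nat.mul_pos hP hQ
      omega
    · exact h0
  have hR : ((P : ℝ) * Q) ≤ c * M := by exact_mod_cast h
  have := Real.log_le_log (by positivity) hR
  rwa [Real.log_mul (by positivity) (by positivity),
    Real.log_mul (by positivity) (by positivity)] at this

theorem mul_pow_lt_of_log {c d x y e f : ℕ} (hd : 0 < d) (hx : 0 < x) (hc : 0 < c) (hy : 0 < y)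
    (h : Real.log c + e * Real.log x < Real.log d + f * Real.log y) :
    c * x ^ e < d * y ^ f := by
  have : (c : ℝ) * x ^ e < d * y ^ f := by
    rw [← Real.log_lt_log_iff (by positivity) (by positivity),
      Real.log_mul (by positivity) (by positivity), Real.log_mul (by positivity) (by positivity),
      Real.log_pow, Real.log_pow]
    exact h
  exact_mod_cast this

/-- `exists_gap_sequence` along an increasing finite sequence `b 0 < ⋯ < b s`. -/
theorem exists_gap_sequence_of_strictMono {k s a a' : ℕ} {n : ℤ} {b : ℕ → ℕ} (hk : 3 ≤ k)
    (hn : n ≠ 0) (ha : 0 < a) (haa' : a < a') (hb : ∀ i j, i < j → j ≤ s → b i < b j)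
    (hbn : 2 * n.natAbs ≤ b 0)
    (hba : ∀ i ≤ s, ∃ x : ℕ, 0 < x ∧ (a * b i : ℤ) + n = (x : ℤ) ^ k)
    (hba' : ∀ i ≤ s, ∃ x : ℕ, 0 < x ∧ (a' * b i : ℤ) + n = (x : ℤ) ^ k) :
    ∃ (D : ℕ) (M : ℕ → ℕ), 0 < D ∧ D ≤ n.natAbs * a' ∧ (∀ i ≤ s, 0 < M i) ∧
      a * a' * b 0 ≤ 2 * M 0 ∧
      (∀ i < s, k ^ k * (a * a') * M i ^ (k - 1) ≤ 2 * D ^ k * M (i + 1)) ∧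
      ∀ i j, i < j → j ≤ s → ∀ R : ℕ,
        k ^ (2 * k) * D ^ (2 * (k - 1)) ≤ M i ^ (k - 2) →
        2 ^ (6 * R + 10) * k ^ (2 * R * k) * D ^ ((2 * R + 1) * k) * M i ^ (2 * R + 4) <
          a * a' * k ^ k * 4 ^ (R * k) * M i ^ ((R + 1) * k) * D ^ (2 * R + 2) →
        2 ^ (6 * R + 3) * M i ^ (2 * R + 1) < M j * D ^ (2 * R) → False := by
  have hmem : ∀ i ≤ s, b i ∈ b '' Set.Iic s := fun i hi => Set.mem_image_of_mem b hi
  obtain ⟨D, M, hD, hDn, hM0, hM, hgap, hfalse⟩ := exists_gap_sequence (n := n) hk hn ha haa'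
    (b '' Set.Iic s)
    (by
      rintro _ ⟨i, hi, rfl⟩
      rcases Nat.eq_zero_or_pos i with rfl | h0
      · exact hbn
      · exact hbn.trans (hb 0 i h0 hi).le)
    (by rintro _ ⟨i, hi, rfl⟩; exact hba i hi) (by rintro _ ⟨i, hi, rfl⟩; exact hba' i hi)
  exact ⟨D, fun i => M (b i), hD, hDn, fun i hi => hM0 _ (hmem i hi), hM _ (hmem 0 (Nat.zero_le _)),
    fun i hi => hgap _ (hmem i hi.le) _ (hmem (i + 1) hi) (hb _ _ (Nat.lt_succ_self i) hi),
    fun i j hij hj => hfalse _ (hmem i (hij.le.trans hj)) _ (hmem j hj) (hb i j hij hj)⟩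

theorem two_mul_le_of_rpow_le {N B : ℕ} {t : ℝ} (ht : 1 ≤ t) (hN : 0 < N)
    (hB : 2 * (N : ℝ) ^ t ≤ B) : 2 * N ≤ B := by
  have h1 : (1 : ℝ) ≤ N := by exact_mod_cast hN
  have h2 := Real.rpow_le_rpow_of_exponent_le h1 ht
  rw [Real.rpow_one] at h2
  have : (2 * N : ℝ) ≤ B := by linarith
  exact_mod_cast this

theorem log_two_add_mul_log_le {N B : ℕ} {t : ℝ} (hN : 0 < N) (hB : 2 * (N : ℝ) ^ t ≤ B) :
    Real.log 2 + t * Real.log N ≤ Real.log B := by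
  have h := Real.log_le_log (by positivity) hB
  rwa [Real.log_mul (by norm_num) (by positivity), Real.log_rpow (by positivity)] at h

theorem pow_le_pow_of_rpow_le {N B e f : ℕ} {t : ℝ} (hN : 0 < N) (hB : 2 * (N : ℝ) ^ t ≤ B)
    (hef : (f : ℝ) ≤ t * e) : N ^ f ≤ B ^ e := by
  have h1 : (1 : ℝ) ≤ N := by exact_mod_cast hN
  have h0 : (0 : ℝ) < (N : ℝ) ^ t := by positivity
  have : (N : ℝ) ^ f ≤ (B : ℝ) ^ e := by
    calc (N : ℝ) ^ f = (N : ℝ) ^ (f : ℝ) := (Real.rpow_natCast _ _).symm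
      _ ≤ (N : ℝ) ^ (t * e) := Real.rpow_le_rpow_of_exponent_le h1 hef
      _ = ((N : ℝ) ^ t) ^ e := by rw [Real.rpow_mul (by positivity), Real.rpow_natCast]
      _ ≤ (B : ℝ) ^ e := by gcongr; linarith
  exact_mod_cast this

section

variable {k a a' : ℕ} {n : ℤ} {b : ℕ → ℕ} {t : ℝ}

theorem false_of_six_le (hk : 6 ≤ k) (hn : n ≠ 0) (ha : 0 < a) (haa' : a < a')
    (hb : ∀ i j, i < j → j ≤ 2 → b i < b j)
    (hba : ∀ i ≤ 2, ∃ x : ℕ, 0 < x ∧ (a * b i : ℤ) + n = (x : ℤ) ^ k)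
    (hba' : ∀ i ≤ 2, ∃ x : ℕ, 0 < x ∧ (a' * b i : ℤ) + n = (x : ℤ) ^ k)
    (ha'b : a' ≤ b 0) (ht1 : 1 ≤ t) (ht : (k : ℝ) ^ 2 - 2 ≤ t * ((k - 1) * (k - 4)))
    (hB : 2 * (n.natAbs : ℝ) ^ t ≤ b 0) : False := by
  have hN : 0 < n.natAbs := by omega
  have hP : 0 < a * a' := Nat.mul_pos ha (ha.trans haa')
  obtain ⟨D, M, hD, hDn, hM, hM0, hgap, hfalse⟩ := exists_gap_sequence_of_strictMono
    (by omega : 3 ≤ k) hn ha haa' hb (two_mul_le_of_rpow_le ht1 hN hB) hba hba'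
  have hS := pow_le_of_growth hk hD hDn (Nat.le_mul_of_pos_left a' ha) ha'b
    (pow_le_pow_of_rpow_le hN hB (by
      rw [Nat.cast_sub (by nlinarith), Nat.cast_mul, Nat.cast_sub (by omega),
        Nat.cast_sub (by omega)]
      push_cast
      exact ht)) hM0 (hgap 0 (by norm_num))
  have hG := mul_lt_of_gap (by omega) hP hD (hM 1 (by norm_num)) hS (hgap 1 (by norm_num))
  have hB' := mul_pow_lt_of_pow_le hk hP hD (hM 1 (by norm_num)) hS
  refine hfalse 1 2 (by norm_num) le_rfl 0 hS ?_ ?_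
  · simpa using hB'
  · simpa using hG

theorem false_of_eq_five (hn : n ≠ 0) (ha : 0 < a) (haa' : a < a')
    (hb : ∀ i j, i < j → j ≤ 3 → b i < b j)
    (hba : ∀ i ≤ 3, ∃ x : ℕ, 0 < x ∧ (a * b i : ℤ) + n = (x : ℤ) ^ 5)
    (hba' : ∀ i ≤ 3, ∃ x : ℕ, 0 < x ∧ (a' * b i : ℤ) + n = (x : ℤ) ^ 5)
    (ha'b : a' ≤ b 0) (ht : 4 ≤ t) (hB : 2 * (n.natAbs : ℝ) ^ t ≤ b 0) : False := by
  have hN : 0 < n.natAbs := by omega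
  have ha' : 0 < a' := ha.trans haa'
  have hP : 0 < a * a' := Nat.mul_pos ha ha'
  obtain ⟨D, M, hD, hDn, hM, hM0, hgap, hfalse⟩ := exists_gap_sequence_of_strictMono
    (by norm_num : 3 ≤ 5) hn ha haa' hb (two_mul_le_of_rpow_le (by linarith) hN hB) hba hba'
  have hlogs : ∀ z : ℕ, 0 < z → 0 ≤ Real.log z := fun z hz =>
    Real.log_nonneg (by exact_mod_cast hz)
  have hlog : ∀ {z w : ℕ}, 0 < z → z ≤ w → Real.log z ≤ Real.log w := fun hz hzw =>
    Real.log_le_log (by exact_mod_cast hz) (by exact_mod_cast hzw)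
  have g0 := log_gap (by norm_num) hP hD (hM 0 (by norm_num)) (hM 1 (by norm_num))
    (hgap 0 (by norm_num))
  have g1 := log_gap (by norm_num) hP hD (hM 1 (by norm_num)) (hM 2 (by norm_num))
    (hgap 1 (by norm_num))
  have m0 := log_add_log_le hP (ha'.trans_le ha'b) (by norm_num) hM0
  have hb0 := log_two_add_mul_log_le hN hB
  have hd : Real.log D ≤ Real.log n.natAbs + Real.log a' := by
    have := hlog hD hDn
    rwa [Nat.cast_mul, Real.log_mul (by positivity) (by positivity)] at this
  have hq1 := hlog ha' (Nat.le_mul_of_pos_left a' ha)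
  have hq2 := hlog ha' ha'b
  have hd0 := hlogs D hD
  have hN0 := hlogs _ hN
  have hp0 := hlogs _ hP
  have l2 := Real.log_pos (show (1 : ℝ) < 2 by norm_num)
  have l5 : 2 * Real.log 2 ≤ Real.log 5 := by
    rw [← Real.log_rpow (by norm_num)]
    exact Real.log_le_log (by positivity) (by norm_num)
  have htN := mul_le_mul_of_nonneg_right ht hN0
  generalize hpe : Real.log (a * a' : ℕ) = p at *
  push_cast at g0 g1 m0
  have hS : 5 ^ (2 * 5) * D ^ (2 * (5 - 1)) ≤ M 2 ^ (5 - 2) := by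
    have := mul_pow_lt_of_log (c := 5 ^ 10) (d := 1) (x := D) (y := M 2)
      (e := 8) (f := 3) (by norm_num) hD (by norm_num)
      (hM 2 (by norm_num)) (by
        rw [Nat.cast_one, Real.log_one, Nat.cast_pow, Real.log_pow]
        push_cast
        linarith)
    simpa using this.le
  have hG := mul_lt_of_gap (by norm_num) hP hD (hM 2 (by norm_num)) hS (hgap 2 (by norm_num))
  refine hfalse 2 3 (by norm_num) le_rfl 0 hS ?_ (by simpa using hG)
  have hDM : D ^ 3 ≤ M 2 := by
    have := mul_pow_lt_of_log (c := 1) (d := 1) (x := D) (y := M 2)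
      (e := 3) (f := 1) (by norm_num) hD (by norm_num)
      (hM 2 (by norm_num)) (by
        push_cast
        linarith)
    simpa using this.le
  calc _ = 1024 * (D ^ 3 * M 2 ^ 4 * D ^ 2) := by ring
    _ < 3125 * (M 2 * M 2 ^ 4 * D ^ 2) := by
      have := hM 2 (by norm_num)
      have h1 : D ^ 3 * M 2 ^ 4 * D ^ 2 ≤ M 2 * M 2 ^ 4 * D ^ 2 := by gcongr
      have : 0 < M 2 * M 2 ^ 4 * D ^ 2 := by positivity
      omega
    _ ≤ (a * a') * (3125 * (M 2 * M 2 ^ 4 * D ^ 2)) := Nat.le_mul_of_pos_left _ hP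
    _ = _ := by ring

theorem false_of_eq_four (hn : n ≠ 0) (ha : 0 < a) (haa' : a < a')
    (hb : ∀ i j, i < j → j ≤ 4 → b i < b j)
    (hba : ∀ i ≤ 4, ∃ x : ℕ, 0 < x ∧ (a * b i : ℤ) + n = (x : ℤ) ^ 4)
    (hba' : ∀ i ≤ 4, ∃ x : ℕ, 0 < x ∧ (a' * b i : ℤ) + n = (x : ℤ) ^ 4)
    (ha'b : a' ≤ b 0) (ht : 11 ≤ t) (hB : 2 * (n.natAbs : ℝ) ^ t ≤ b 0) : False := by
  have hN : 0 < n.natAbs := by omega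
  have ha' : 0 < a' := ha.trans haa'
  have hP : 0 < a * a' := Nat.mul_pos ha ha'
  obtain ⟨D, M, hD, hDn, hM, hM0, hgap, hfalse⟩ := exists_gap_sequence_of_strictMono
    (by norm_num : 3 ≤ 4) hn ha haa' hb (two_mul_le_of_rpow_le (by linarith) hN hB) hba hba'
  have hlogs : ∀ z : ℕ, 0 < z → 0 ≤ Real.log z := fun z hz =>
    Real.log_nonneg (by exact_mod_cast hz)
  have hlog : ∀ {z w : ℕ}, 0 < z → z ≤ w → Real.log z ≤ Real.log w := fun hz hzw =>
    Real.log_le_log (by exact_mod_cast hz) (by exact_mod_cast hzw)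
  have g0 := log_gap (by norm_num) hP hD (hM 0 (by norm_num)) (hM 1 (by norm_num))
    (hgap 0 (by norm_num))
  have g1 := log_gap (by norm_num) hP hD (hM 1 (by norm_num)) (hM 2 (by norm_num))
    (hgap 1 (by norm_num))
  have g2 := log_gap (by norm_num) hP hD (hM 2 (by norm_num)) (hM 3 (by norm_num))
    (hgap 2 (by norm_num))
  have g3 := log_gap (by norm_num) hP hD (hM 3 (by norm_num)) (hM 4 (by norm_num))
    (hgap 3 (by norm_num))
  have m0 := log_add_log_le hP (ha'.trans_le ha'b) (by norm_num) hM0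
  have hb0 := log_two_add_mul_log_le hN hB
  have hd : Real.log D ≤ Real.log n.natAbs + Real.log a' := by
    have := hlog hD hDn
    rwa [Nat.cast_mul, Real.log_mul (by positivity) (by positivity)] at this
  have hq1 := hlog ha' (Nat.le_mul_of_pos_left a' ha)
  have hq2 := hlog ha' ha'b
  have hd0 := hlogs D hD
  have hN0 := hlogs _ hN
  have hp0 := hlogs _ hP
  have l2 := Real.log_pos (show (1 : ℝ) < 2 by norm_num)
  have l4 : Real.log 4 = 2 * Real.log 2 := by
    rw [← Real.log_rpow (by norm_num)]
    norm_num
  have htN := mul_le_mul_of_nonneg_right ht hN0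
  generalize hpe : Real.log (a * a' : ℕ) = p at *
  push_cast at g0 g1 g2 g3 m0
  rw [l4] at g0 g1 g2 g3
  have hM2 := hM 2 (by norm_num)
  refine hfalse 2 4 (by norm_num) le_rfl 1 ?_ ?_ ?_
  · have := mul_pow_lt_of_log (c := 2 ^ 16) (d := 1) (x := D) (y := M 2) (e := 6) (f := 2)
      (by norm_num) hD (by norm_num) hM2 (by
        rw [Nat.cast_one, Real.log_one, Nat.cast_pow, Real.log_pow]
        push_cast
        linarith)
    simpa using this.le
  · have := mul_pow_lt_of_log (c := 2 ^ 16) (d := a * a') (x := D) (y := M 2) (e := 8) (f := 2)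
      hP hD (by norm_num) hM2 (by
        rw [hpe, Nat.cast_pow, Real.log_pow]
        push_cast
        linarith)
    calc _ = (4 ^ 8 * D ^ 4 * M 2 ^ 6) * (2 ^ 16 * D ^ 8) := by ring
      _ < (4 ^ 8 * D ^ 4 * M 2 ^ 6) * (a * a' * M 2 ^ 2) := by gcongr
      _ = _ := by ring
  · have := mul_pow_lt_of_log (c := 2 ^ 9) (d := M 4) (x := M 2) (y := D) (e := 3) (f := 2)
      (hM 4 le_rfl) hM2 (by norm_num) hD (by
        rw [Nat.cast_pow, Real.log_pow]
        push_cast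
        linarith)
    simpa using this

/-- The case `k = 3`, in logarithmic form: `hS`, `hB'` and `hG` are estimates for the product
`a * a'` and the length `a'`. -/
theorem false_of_eq_three (hn : n ≠ 0) (ha : 0 < a) (haa' : a < a')
    (hb : ∀ i j, i < j → j ≤ 6 → b i < b j)
    (hba : ∀ i ≤ 6, ∃ x : ℕ, 0 < x ∧ (a * b i : ℤ) + n = (x : ℤ) ^ 3)
    (hba' : ∀ i ≤ 6, ∃ x : ℕ, 0 < x ∧ (a' * b i : ℤ) + n = (x : ℤ) ^ 3)
    (ht : 1 ≤ t) (hB : 2 * (n.natAbs : ℝ) ^ t ≤ b 0)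
    (hS : 25 * (Real.log n.natAbs + Real.log a') ≤
      15 * (Real.log a + Real.log a') + 8 * Real.log (b 0))
    (hB' : 55 * (Real.log n.natAbs + Real.log a') ≤
      31 * (Real.log a + Real.log a') + 16 * Real.log (b 0))
    (hG : 36 * (Real.log n.natAbs + Real.log a') ≤
      22 * (Real.log a + Real.log a') + 8 * Real.log (b 0)) : False := by
  have hN : 0 < n.natAbs := by omega
  have ha' : 0 < a' := ha.trans haa'
  have hP : 0 < a * a' := Nat.mul_pos ha ha'
  have h2N := two_mul_le_of_rpow_le ht hN hB
  obtain ⟨D, M, hD, hDn, hM, hM0, hgap, hfalse⟩ := exists_gap_sequence_of_strictMono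
    (by norm_num : 3 ≤ 3) hn ha haa' hb h2N hba hba'
  have g := fun i (hi : i < 6) => log_gap (by norm_num) hP hD (hM i hi.le) (hM (i + 1) hi)
    (hgap i hi)
  have g0 := g 0 (by norm_num)
  have g1 := g 1 (by norm_num)
  have g2 := g 2 (by norm_num)
  have g3 := g 3 (by norm_num)
  have g4 := g 4 (by norm_num)
  have g5 := g 5 (by norm_num)
  have m0 := log_add_log_le hP (show 0 < b 0 by omega) (by norm_num) hM0
  have hd : Real.log D ≤ Real.log n.natAbs + Real.log a' := by
    have := Real.log_le_log (by positivity)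
      (show (D : ℝ) ≤ (n.natAbs * a' : ℕ) by exact_mod_cast hDn)
    rwa [Nat.cast_mul, Real.log_mul (by positivity) (by positivity)] at this
  have hp : Real.log (a * a' : ℕ) = Real.log a + Real.log a' := by
    rw [Nat.cast_mul, Real.log_mul (by positivity) (by positivity)]
  have l2 := Real.log_pos (show (1 : ℝ) < 2 by norm_num)
  have l3 : 3 * Real.log 2 ≤ 2 * Real.log 3 := by
    rw [← Real.log_rpow (by norm_num), ← Real.log_rpow (by norm_num)]
    exact Real.log_le_log (by positivity) (by norm_num)
  have l3' : 5 * Real.log 3 ≤ 8 * Real.log 2 := by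
    rw [← Real.log_rpow (by norm_num), ← Real.log_rpow (by norm_num)]
    exact Real.log_le_log (by positivity) (by norm_num)
  clear g hgap
  rw [← hp] at hS hB' hG
  generalize hpe : Real.log (a * a' : ℕ) = p at *
  push_cast at g0 g1 g2 g3 g4 g5 m0
  have hM3 := hM 3 (by norm_num)
  refine hfalse 3 6 (by norm_num) le_rfl 3 ?_ ?_ ?_
  · have := mul_pow_lt_of_log (c := 3 ^ 6) (d := 1) (x := D) (y := M 3) (e := 4) (f := 1)
      (by norm_num) hD (by norm_num) hM3 (by
        rw [Nat.cast_one, Real.log_one, Nat.cast_pow, Real.log_pow]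
        push_cast
        linarith)
    simpa using this.le
  · have := mul_pow_lt_of_log (c := 2 ^ 10 * 3 ^ 15) (d := a * a') (x := D) (y := M 3) (e := 13)
      (f := 2) hP hD (by norm_num) hM3 (by
        rw [hpe]
        rw [Nat.cast_mul, Nat.cast_pow, Nat.cast_pow, Real.log_mul (by norm_num) (by norm_num),
          Real.log_pow, Real.log_pow]
        push_cast
        linarith)
    calc _ = (2 ^ 18 * 3 ^ 3 * D ^ 8 * M 3 ^ 10) * (2 ^ 10 * 3 ^ 15 * D ^ 13) := by ring
      _ < (2 ^ 18 * 3 ^ 3 * D ^ 8 * M 3 ^ 10) * (a * a' * M 3 ^ 2) := by gcongr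
      _ = _ := by ring
  · have := mul_pow_lt_of_log (c := 2 ^ 21) (d := M 6) (x := M 3) (y := D) (e := 7) (f := 6)
      (hM 6 le_rfl) hM3 (by norm_num) hD (by
        rw [Nat.cast_pow, Real.log_pow]
        push_cast
        linarith)
    simpa using this

end

theorem le_cast_of_lt_ncard {s m : ℕ} {b : ℕ → ℕ} {c : ℝ}
    (hb : ∀ i j, i < j → j < m → b i < b j)
    (h : s < Set.ncard {j : ℕ | j < m ∧ c ≤ (b j : ℝ)}) : c ≤ b (m - s - 1) := by
  by_contra! hc
  have hsub : {j : ℕ | j < m ∧ c ≤ (b j : ℝ)} ⊆ (Finset.Ico (m - s) m : Finset ℕ) := by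
    rintro j ⟨hj, hcj⟩
    rw [Finset.coe_Ico, Set.mem_Ico]
    refine ⟨?_, hj⟩
    by_contra! hjs
    have hle : b j ≤ b (m - s - 1) := by
      rcases (show j ≤ m - s - 1 by omega).eq_or_lt with rfl | hlt
      · exact le_rfl
      · exact (hb _ _ hlt (by omega)).le
    have : (b j : ℝ) ≤ b (m - s - 1) := by exact_mod_cast hle
    linarith
  have hcard := Set.ncard_le_ncard hsub (Finset.finite_toSet _)
  rw [Set.ncard_coe_finset, Nat.card_Ico] at hcard
  omega

/-- The case `k = 3`, with three elements `a 0 < a 1 < a 2` available. If `a 1` is small compared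
with `b 0` the pair `(a 0, a 1)` gives a contradiction, and otherwise `(a 1, a 2)` does. -/
theorem false_of_eq_three_of_three_le {n : ℤ} {a b : ℕ → ℕ} {t : ℝ} (hn : n ≠ 0) (ha : 0 < a 0)
    (ha01 : a 0 < a 1) (ha12 : a 1 < a 2) (hb : ∀ i j, i < j → j ≤ 6 → b i < b j)
    (hab : ∀ j ≤ 2, ∀ i ≤ 6, ∃ x : ℕ, 0 < x ∧ (a j * b i : ℤ) + n = (x : ℤ) ^ 3)
    (ha2b : a 2 ≤ b 0) (ht : 15 ≤ t) (hB : 2 * (n.natAbs : ℝ) ^ t ≤ b 0) : False := by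
  have hN : 0 < n.natAbs := Int.natAbs_pos.mpr hn
  have hlog2 : 0 < Real.log 2 := Real.log_pos (by norm_num)
  have hL := Real.log_natCast_nonneg n.natAbs
  have hβ := log_two_add_mul_log_le hN hB
  have hβ' : 15 * Real.log n.natAbs ≤ Real.log (b 0) := by nlinarith
  have h0 := Real.log_natCast_nonneg (a 0)
  have h2 : Real.log (a 2) ≤ Real.log (b 0) :=
    Real.log_le_log (by exact_mod_cast ha.trans (ha01.trans ha12)) (by exact_mod_cast ha2b)
  by_cases h1 : 5 * Real.log (a 1) ≤ 2 * Real.log (b 0)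
  · exact false_of_eq_three hn ha ha01 hb (hab 0 (by norm_num)) (hab 1 (by norm_num))
      (by linarith) hB (by linarith) (by linarith) (by linarith)
  · push Not at h1
    exact false_of_eq_three hn (ha.trans ha01) ha12 hb (hab 1 (by norm_num)) (hab 2 le_rfl)
      (by linarith) hB (by linarith) (by linarith) (by linarith)

theorem sConst_of_six_le {k : ℕ} (hk : 6 ≤ k) : sConst k = 2 := by
  obtain ⟨K, rfl⟩ := Nat.exists_eq_add_of_le' hk
  rfl

theorem tConst_of_six_le {k : ℕ} (hk : 6 ≤ k) :
    1 ≤ tConst k ∧ (k : ℝ) ^ 2 - 2 ≤ tConst k * ((k - 1) * (k - 4)) := by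
  rcases hk.eq_or_lt with rfl | hk
  · norm_num [tConst]
  · obtain ⟨K, rfl⟩ := Nat.exists_eq_add_of_le' hk
    have hK : (0 : ℝ) ≤ K := K.cast_nonneg
    have hden : 0 < ((K + 6 + 1 : ℕ) : ℝ) ^ 2 - 6 * ((K + 6 + 1 : ℕ) : ℝ) + 6 := by
      push_cast
      nlinarith
    have ht : tConst (K + 6 + 1) = (((K + 6 + 1 : ℕ) : ℝ) ^ 2 + ((K + 6 + 1 : ℕ) : ℝ) - 4) /
        (((K + 6 + 1 : ℕ) : ℝ) ^ 2 - 6 * ((K + 6 + 1 : ℕ) : ℝ) + 6) := rfl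
    rw [ht, one_le_div hden, div_mul_eq_mul_div, le_div_iff₀ hden]
    push_cast
    constructor
    · nlinarith
    · have : 0 ≤ (K : ℝ) ^ 2 := by positivity
      have : 0 ≤ (K : ℝ) ^ 3 := by positivity
      nlinarith

/-- Proposition 2.1: with the listed assumptions, at most `s_k` elements of `B` are
at least `2|n|^{t_k}`.  Here `A = {a 0 < a 1 < ⋯ < a (ℓ-1)}` and
`B = {b 0 < b 1 < ⋯ < b (m-1)}` (0-indexed), so `a₂ = a 1`, `a₃ = a 2`,
`b_{m - s_k} = b (m - sConst k - 1)`, and `b_{m-6} = b (m - 7)`. -/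
theorem bipartite_diophantine_local_bound
    (k : ℕ) (n : ℤ) (hk : 3 ≤ k) (hn : n ≠ 0)
    (ℓ m : ℕ) (a b : ℕ → ℕ)
    (hapos : ∀ i, i < ℓ → 0 < a i)
    (hbpos : ∀ j, j < m → 0 < b j)
    (hamono : ∀ i j, i < j → j < ℓ → a i < a j)
    (hbmono : ∀ i j, i < j → j < m → b i < b j)
    (hpow : ∀ i, i < ℓ → ∀ j, j < m →
      ∃ x : ℕ, 0 < x ∧ (a i * b j : ℤ) + n = (x : ℤ) ^ k)
    (hgt3 : 3 < k → sConst k + 1 ≤ m ∧ 2 ≤ ℓ ∧ a 1 ≤ b (m - sConst k - 1))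
    (heq3 : k = 3 → 7 ≤ m ∧ 3 ≤ ℓ ∧ a 2 ≤ b (m - 7)) :
    Set.ncard {j : ℕ | j < m ∧ 2 * |(n : ℝ)| ^ tConst k ≤ (b j : ℝ)} ≤ sConst k := by
  by_contra! hcard
  have hB := le_cast_of_lt_ncard hbmono hcard
  rw [← Int.cast_abs, ← Nat.cast_natAbs] at hB
  have hbs : sConst k + 1 ≤ m → ∀ i j, i < j → j ≤ sConst k →
      b (m - sConst k - 1 + i) < b (m - sConst k - 1 + j) :=
    fun hm i j hij hj => hbmono _ _ (by omega) (by omega)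
  have hab : sConst k + 1 ≤ m → ∀ j < ℓ, ∀ i ≤ sConst k,
      ∃ x : ℕ, 0 < x ∧ (a j * b (m - sConst k - 1 + i) : ℤ) + n = (x : ℤ) ^ k :=
    fun hm j hj i hi => hpow j hj _ (by omega)
  rcases hk.eq_or_lt with rfl | hk4
  · obtain ⟨hm, hℓ, ha2b⟩ := heq3 rfl
    exact false_of_eq_three_of_three_le (b := fun i => b (m - 6 - 1 + i)) hn
      (hapos 0 (by omega)) (hamono 0 1 one_pos (by omega)) (hamono 1 2 one_lt_two (by omega))
      (hbs hm) (fun j hj => hab hm j (by omega)) ha2b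
      (show (15 : ℝ) ≤ 15399 / 938 by norm_num) hB
  obtain ⟨hm, hℓ, ha1b⟩ := hgt3 hk4
  have ha0 := hapos 0 (by omega)
  have ha01 := hamono 0 1 one_pos hℓ
  have hab0 := hab hm 0 (by omega)
  have hab1 := hab hm 1 (by omega)
  rcases (show k = 4 ∨ k = 5 ∨ 6 ≤ k by omega) with rfl | rfl | hk6
  · exact false_of_eq_four (b := fun i => b (m - 4 - 1 + i)) hn ha0 ha01 (hbs hm) hab0 hab1 ha1b
      (show (11 : ℝ) ≤ 34 / 3 by norm_num) hB
  · exact false_of_eq_five (b := fun i => b (m - 3 - 1 + i)) hn ha0 ha01 (hbs hm) hab0 hab1 ha1b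
      (show (4 : ℝ) ≤ 97 / 23 by norm_num) hB
  · obtain ⟨ht1, ht⟩ := tConst_of_six_le hk6
    rw [sConst_of_six_le hk6] at hbs hm hab0 hab1 ha1b hB
    exact false_of_six_le (b := fun i => b (m - 2 - 1 + i)) hk6 hn ha0 ha01 (hbs hm) hab0 hab1
      ha1b ht1 ht hB
end

section
/- Let k ≥ 3 be an integer and let n be a nonzero integer. Let a, b, c, d be positive integers with a < b, c < d, and ac ≥ 2|n|. Suppose that ac + n, bc + n, ad + n, and bd + n are all k-th powers of positive integers. Then bd ≥ k^k · (ac)^{k−1} / (4^{k−1} · |n|^k). -/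
theorem pow_add_mul_pow_le_add_one_pow (V : ℤ) (hV : 0 ≤ V) (m : ℕ) :
    V ^ (m + 1) + (m + 1) * V ^ m ≤ (V + 1) ^ (m + 1) := by
  induction m with
  | zero => simp
  | succ m ih =>
    have h := mul_le_mul_of_nonneg_right ih (by lia : 0 ≤ V + 1)
    have h₀ : 0 ≤ ((m : ℤ) + 1) * V ^ m := by positivity
    calc V ^ (m + 1 + 1) + ((m + 1 : ℕ) + 1) * V ^ (m + 1)
        ≤ (V ^ (m + 1) + (m + 1) * V ^ m) * (V + 1) := by
          push_cast
          linear_combination h₀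
      _ ≤ (V + 1) ^ (m + 1 + 1) := by rwa [pow_succ (V + 1) (m + 1)]

/-- Distinct `(m + 1)`-th powers `V ^ (m + 1) < U ^ (m + 1)` with `A * B ≤ 4 * V ^ (m + 1)` whose
difference is at most `N * B` force `B` to be large in terms of `A` and `N`. -/
theorem pow_mul_pow_le_of_pow_sub_pow_le {m : ℕ} {U V A B N : ℤ} (hV : 0 ≤ V)
    (hA : 0 ≤ A) (hB : 0 < B) (hUV : V < U)
    (hsub : U ^ (m + 1) - V ^ (m + 1) ≤ N * B) (hAB : A * B ≤ 4 * V ^ (m + 1)) :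
    (m + 1) ^ (m + 1) * A ^ m ≤ B * (4 ^ m * N ^ (m + 1)) := by
  have hU : (V + 1) ^ (m + 1) ≤ U ^ (m + 1) := pow_le_pow_left₀ (by lia) hUV _
  have hgap : (m + 1) * V ^ m ≤ N * B := by
    linarith [pow_add_mul_pow_le_add_one_pow V hV m]
  have hAB' : (A * B) ^ m ≤ (4 * V ^ (m + 1)) ^ m := pow_le_pow_left₀ (by positivity) hAB m
  refine le_of_mul_le_mul_right ?_ (pow_pos hB m)
  calc (m + 1) ^ (m + 1) * A ^ m * B ^ m
      = (m + 1) ^ (m + 1) * (A * B) ^ m := by ring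
    _ ≤ (m + 1) ^ (m + 1) * (4 * V ^ (m + 1)) ^ m := by gcongr
    _ = 4 ^ m * ((m + 1) * V ^ m) ^ (m + 1) := by
        rw [mul_pow, mul_pow, ← pow_mul, ← pow_mul, mul_comm (m + 1) m]
        ring
    _ ≤ 4 ^ m * (N * B) ^ (m + 1) := by gcongr
    _ = B * (4 ^ m * N ^ (m + 1)) * B ^ m := by ring

/-- Lemma 2.3 (gap principle): if `a < b`, `c < d`, `ac ≥ 2|n|`, and
`ac + n, bc + n, ad + n, bd + n` are all `k`-th powers of positive integers,
then `bd ≥ k^k (ac)^{k-1} / (4^{k-1} |n|^k)`. -/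
theorem gap_principle (k : ℕ) (n : ℤ) (hk : 3 ≤ k) (hn : n ≠ 0)
    (a b c d : ℕ) (ha : 0 < a) (hc : 0 < c) (hab : a < b) (hcd : c < d)
    (hac : 2 * |n| ≤ (a * c : ℤ))
    (h1 : ∃ x : ℕ, 0 < x ∧ (a * c : ℤ) + n = (x : ℤ) ^ k)
    (h2 : ∃ x : ℕ, 0 < x ∧ (b * c : ℤ) + n = (x : ℤ) ^ k)
    (h3 : ∃ x : ℕ, 0 < x ∧ (a * d : ℤ) + n = (x : ℤ) ^ k)
    (h4 : ∃ x : ℕ, 0 < x ∧ (b * d : ℤ) + n = (x : ℤ) ^ k) :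
    (k : ℝ) ^ k * ((a * c : ℕ) : ℝ) ^ (k - 1) / (4 ^ (k - 1) * |(n : ℝ)| ^ k)
      ≤ ((b * d : ℕ) : ℝ) := by
  obtain ⟨x, hx, h1⟩ := h1
  obtain ⟨y, hy, h2⟩ := h2
  obtain ⟨z, hz, h3⟩ := h3
  obtain ⟨w, hw, h4⟩ := h4
  obtain ⟨m, rfl⟩ : ∃ m, k = m + 1 := ⟨k - 1, by lia⟩
  have ha' : (0 : ℤ) < a := by exact_mod_cast ha
  have hc' : (0 : ℤ) < c := by exact_mod_cast hc
  have hab' : (a : ℤ) < b := by exact_mod_cast hab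
  have hcd' : (c : ℤ) < d := by exact_mod_cast hcd
  have hA : (0 : ℤ) < a * c := mul_pos ha' hc'
  have hB : (0 : ℤ) < b * d := mul_pos (ha'.trans hab') (hc'.trans hcd')
  have hAB : (a * c : ℤ) ≤ b * d := by gcongr
  have hdiag : (x * w : ℤ) ^ (m + 1) = (a * c + n) * (b * d + n) := by rw [mul_pow, h1, h4]
  have hoff : (y * z : ℤ) ^ (m + 1) = (b * c + n) * (a * d + n) := by rw [mul_pow, h2, h3]
  have hdiff : (x * w : ℤ) ^ (m + 1) - (y * z : ℤ) ^ (m + 1) = n * ((b - a) * (d - c)) := by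
    rw [hdiag, hoff]
    ring
  have hpos : (0 : ℤ) < (b - a) * (d - c) := mul_pos (by lia) (by lia)
  have hle : ((b : ℤ) - a) * (d - c) ≤ b * d := by
    apply mul_le_mul <;> lia
  have key : ((m : ℤ) + 1) ^ (m + 1) * (a * c) ^ m ≤ (b * d) * (4 ^ m * |n| ^ (m + 1)) := by
    rcases lt_or_gt_of_ne hn with hneg | hpos_n
    · rw [abs_of_neg hneg] at hac ⊢
      refine pow_mul_pow_le_of_pow_sub_pow_le (U := y * z) (V := x * w)
        (by positivity) hA.le hB ?_ ?_ ?_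
      · refine lt_of_pow_lt_pow_left₀ (m + 1) (by positivity) ?_
        linarith [mul_neg_of_neg_of_pos hneg hpos]
      · linarith [mul_le_mul_of_nonneg_left hle (by lia : 0 ≤ -n)]
      · have h : (a * c : ℤ) * (b * d) ≤ (2 * (a * c + n)) * (2 * (b * d + n)) := by
          apply mul_le_mul <;> linarith
        linarith
    · rw [abs_of_pos hpos_n] at hac ⊢
      refine pow_mul_pow_le_of_pow_sub_pow_le (U := x * w) (V := y * z)
        (by positivity) hA.le hB ?_ ?_ ?_
      · refine lt_of_pow_lt_pow_left₀ (m + 1) (by positivity) ?_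
        linarith [mul_pos hpos_n hpos]
      · linarith [mul_le_mul_of_nonneg_left hle hpos_n.le]
      · have hbc : (0 : ℤ) < b * c := mul_pos (ha'.trans hab') hc'
        have had : (0 : ℤ) < a * d := mul_pos ha' (hc'.trans hcd')
        have h : (b * c : ℤ) * (a * d) ≤ (b * c + n) * (a * d + n) := by
          apply mul_le_mul <;> linarith
        linarith [mul_pos hbc had]
  have hn' : 0 < |(n : ℝ)| := abs_pos.mpr (by exact_mod_cast hn)
  rw [Nat.add_sub_cancel, div_le_iff₀ (by positivity)]
  exact_mod_cast key
end
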